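/- arXiv:1902.00992 — 2 statements merged into one kernel-verified Lean document; each statement's English description precedes it below -/
import Mathlib

section
/- Let (Ω,Σ,P) be a probability space, let (X_n) be a sequence of nonnegative P-integrable random variables with sup_n E_P[|X_n|] < ∞, and let K be the convex hull of {X_n : n ∈ ℕ}. The following are equivalent: (1) for every X ∈ K, every forward convex combination of any sequence in K that converges to X in P-probability also converges to X in P-probability (the L^0(P)-topology is locally convex on K); (2) there exists a probability measure Q equivalent to P such that for every sequence (Z_n) in K and every Z ∈ K, (Z_n) converges to Z in P-probability if and only if E_Q[|Z_n − Z|] → 0. -/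
open MeasureTheory Filter Set ProbabilityTheory

noncomputable section

namespace Paper

variable {Ω : Type*} [MeasurableSpace Ω]

/-- The metric `d(X,Y) = E_P[min(|X - Y|, 1)]` metrizing convergence in `P`-probability. -/
def probDist (P : Measure Ω) (X Y : Ω → ℝ) : ℝ :=
  ∫ ω, min |X ω - Y ω| 1 ∂P

/-- `Q` is a probability measure equivalent to `P` (mutually absolutely continuous). -/
def EquivProb (P Q : Measure Ω) : Prop :=
  IsProbabilityMeasure Q ∧ Q ≪ P ∧ P ≪ Q

/-- `K` is a set of `P`-integrable random variables bounded in `L¹(P)`. -/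
def BddL1 (P : Measure Ω) (K : Set (Ω → ℝ)) : Prop :=
  (∀ X ∈ K, Integrable X P) ∧ ∃ C : ℝ, ∀ X ∈ K, (∫ ω, |X ω| ∂P) ≤ C

/-- `K` is `Q`-uniformly integrable: all members are `Q`-integrable and
`sup_{X ∈ K} E_Q[|X| · 1_{|X| > c}] → 0` as `c → ∞`. -/
def UIset (Q : Measure Ω) (K : Set (Ω → ℝ)) : Prop :=
  (∀ X ∈ K, Integrable X Q) ∧
  ∀ ε : ℝ, 0 < ε → ∃ c : ℝ, ∀ X ∈ K, (∫ ω in {ω | c < |X ω|}, |X ω| ∂Q) < ε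

/-- The sequence `Xs` is Cauchy in `P`-probability. -/
def CauchyInProb (P : Measure Ω) (Xs : ℕ → Ω → ℝ) : Prop :=
  ∀ ε : ℝ, 0 < ε →
    Tendsto (fun p : ℕ × ℕ => P {ω | ε ≤ |Xs p.1 ω - Xs p.2 ω|}) atTop (nhds 0)

/-- The (sequential) closure of `K` in the topology of convergence in `P`-probability. -/
def probClosure (P : Measure Ω) (K : Set (Ω → ℝ)) : Set (Ω → ℝ) :=
  {X | ∃ Xs : ℕ → Ω → ℝ, (∀ n, Xs n ∈ K) ∧ TendstoInMeasure P Xs atTop X}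

/-- A set `W` of random variables is solid: if `X ∈ W` and `|Y| ≤ |X|` a.s. then `Y ∈ W`. -/
def SolidSet (P : Measure Ω) (W : Set (Ω → ℝ)) : Prop :=
  ∀ X ∈ W, ∀ Y : Ω → ℝ, AEStronglyMeasurable Y P →
    (∀ᵐ ω ∂P, |Y ω| ≤ |X ω|) → Y ∈ W

/-- The solid hull of a set `A` of random variables. -/
def solidHull (P : Measure Ω) (A : Set (Ω → ℝ)) : Set (Ω → ℝ) :=
  {Y | AEStronglyMeasurable Y P ∧ ∃ X ∈ A, ∀ᵐ ω ∂P, |Y ω| ≤ |X ω|}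

/-- The relative `L⁰(P)`-topology on `K` is uniformly locally convex-solid on `S`:
for every `ε > 0` there is a convex solid set `W` of integrable random variables contained in the
`ε`-ball around `0` such that, for each `X ∈ S`, `(X + W) ∩ K` contains a `d`-ball of `K`
around `X`. -/
def UnifLCS (P : Measure Ω) (K S : Set (Ω → ℝ)) : Prop :=
  ∀ ε : ℝ, 0 < ε → ∃ W : Set (Ω → ℝ),
    (∀ Z ∈ W, Integrable Z P) ∧ Convex ℝ W ∧ SolidSet P W ∧
    (∀ Z ∈ W, probDist P Z 0 < ε) ∧
    ∀ X ∈ S, ∃ δ : ℝ, 0 < δ ∧ ∀ Z ∈ K, probDist P Z X < δ → Z - X ∈ W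

/-- The `L⁰(Q)`- and `L¹(Q)`-topologies agree on `K`: a sequence in `K` converges in
`P`-probability to a member of `K` iff it converges in `L¹(Q)`-norm. -/
def TopAgree (P Q : Measure Ω) (K : Set (Ω → ℝ)) : Prop :=
  ∀ (Xs : ℕ → Ω → ℝ) (X : Ω → ℝ), (∀ n, Xs n ∈ K) → X ∈ K →
    (TendstoInMeasure P Xs atTop X ↔
      Tendsto (fun n => ∫⁻ ω, ENNReal.ofReal |Xs n ω - X ω| ∂Q) atTop (nhds 0))

/-- `W` is a forward convex combination of the sequence `Z`. -/
def IsFCC (Z : ℕ → Ω → ℝ) (W : ℕ → Ω → ℝ) : Prop :=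
  ∀ k, W k ∈ convexHull ℝ (Z '' {n | k ≤ n})

/-- The relative `L⁰(P)`-topology on `K` is locally convex at `X` (forward convex combination
formulation): every FCC of a sequence in `K` converging to `X` in probability also converges
to `X` in probability. -/
def LocConvexAt (P : Measure Ω) (K : Set (Ω → ℝ)) (X : Ω → ℝ) : Prop :=
  ∀ Xs : ℕ → Ω → ℝ, (∀ n, Xs n ∈ K) → TendstoInMeasure P Xs atTop X →
    ∀ W : ℕ → Ω → ℝ, IsFCC Xs W → TendstoInMeasure P W atTop X

/-- The set `L = {Σ_k a_k R_k : Σ_k |a_k| ≤ 1}` (with pointwise a.e. absolutely convergent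
series, which also converge in `L¹(P)`). -/
def Lset (R : ℕ → Ω → ℝ) : Set (Ω → ℝ) :=
  {G | ∃ a : ℕ → ℝ, Summable (fun k => |a k|) ∧ (∑' k, |a k|) ≤ 1 ∧
    G = fun ω => ∑' k, a k * R k ω}

/-- The standard Cauchy distribution on `ℝ`. -/
def cauchyLaw : Measure ℝ :=
  MeasureTheory.volume.withDensity (fun t => ENNReal.ofReal (1 / (Real.pi * (1 + t ^ 2))))

/-- Local convexity of the relative topology on `A ⊆ E` at a point `x ∈ A`, in a topological
vector space. -/
def LocConvexAtTVS {E : Type*} [AddCommGroup E] [Module ℝ E] [TopologicalSpace E]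
    (A : Set E) (x : E) : Prop :=
  ∀ V ∈ nhds (0 : E), ∃ U ∈ nhds (0 : E), ∃ C : Set E,
    Convex ℝ C ∧ ((fun u => x + u) '' U) ∩ A ⊆ C ∧ C ⊆ ((fun v => x + v) '' V) ∩ A

/-- In a real Hilbert space, a family of closed convex sets, one of them bounded, has nonempty
intersection as soon as it has the finite intersection property. -/
theorem nonempty_iInter_of_isClosed_convex {E ι : Type*} [NormedAddCommGroup E]
    [InnerProductSpace ℝ E] [CompleteSpace E] {G : Set E} {C : ι → Set E}
    (hGc : IsClosed G) (hGv : Convex ℝ G) (hGb : Bornology.IsBounded G)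
    (hCc : ∀ i, IsClosed (C i)) (hCv : ∀ i, Convex ℝ (C i))
    (hfip : ∀ F : Finset ι, (G ∩ ⋂ i ∈ F, C i).Nonempty) :
    (G ∩ ⋂ i, C i).Nonempty := by
  have hsurj : Function.Surjective (NormedSpace.inclusionInDoubleDualWeak ℝ E) := by
    intro ψ
    let ψ' : StrongDual ℝ (StrongDual ℝ E) := WeakDual.toStrongDual ψ
    let x : E := (InnerProductSpace.toDual ℝ E).symm <|
      LinearMap.mkContinuous
        { toFun := fun y => ψ' (InnerProductSpace.toDual ℝ E y)
          map_add' := fun y z => by simp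
          map_smul' := fun r y => by simp } ‖ψ'‖ (fun y => by
          simpa using ψ'.le_opNorm (InnerProductSpace.toDual ℝ E y))
    refine ⟨toWeakSpace ℝ E x, ?_⟩
    refine DFunLike.ext _ _ fun f => ?_
    obtain ⟨y, rfl⟩ := (InnerProductSpace.toDual ℝ E).surjective f
    have h1 : inner ℝ x y = ψ' (InnerProductSpace.toDual ℝ E y) := by
      simp [x]
    have h2 : NormedSpace.inclusionInDoubleDualWeak ℝ E (toWeakSpace ℝ E x)
        (InnerProductSpace.toDual ℝ E y) = inner ℝ y x := rfl
    rw [h2, real_inner_comm, h1]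
    rfl
  have hcl : ∀ {s : Set E}, IsClosed s → Convex ℝ s → IsClosed (toWeakSpace ℝ E '' s) := by
    intro s hs hv
    have := hv.toWeakSpace_closure (𝕜 := ℝ)
    rw [hs.closure_eq] at this
    exact closure_eq_iff_isClosed.1 this.symm
  have hcomp : IsCompact (toWeakSpace ℝ E '' G) := by
    have := NormedSpace.isCompact_closure_of_isBounded ℝ E (toWeakSpace ℝ E '' G)
      (by rwa [Set.preimage_image_eq _ (toWeakSpace ℝ E).injective])
      (by rw [hsurj.range_eq]; exact Set.subset_univ _)
    rwa [(hcl hGc hGv).closure_eq] at this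
  have key := hcomp.inter_iInter_nonempty (fun i => toWeakSpace ℝ E '' C i)
    (fun i => hcl (hCc i) (hCv i)) (by
      intro F
      obtain ⟨x, hxG, hxC⟩ := hfip F
      refine ⟨toWeakSpace ℝ E x, Set.mem_image_of_mem _ hxG, ?_⟩
      simp only [Set.mem_iInter] at hxC ⊢
      exact fun i hi => Set.mem_image_of_mem _ (hxC i hi))
  obtain ⟨_, ⟨x, hxG, rfl⟩, hxC⟩ := key
  refine ⟨x, hxG, ?_⟩
  simp only [Set.mem_iInter] at hxC ⊢
  intro i
  exact (Function.Injective.mem_set_image (toWeakSpace ℝ E).injective).1 (hxC i)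

/-- A finite minimax principle: if every convex combination of finitely many convex functions has
a sublevel set at height `c` meeting `G`, then they have a common sublevel set at height
`c' > c`. -/
theorem exists_forall_le_of_convexOn {V ι : Type*} [AddCommGroup V] [Module ℝ V] [Fintype ι]
    {G : Set V} (hG : G.Nonempty) {φ : ι → V → ℝ} (hφ : ∀ i, ConvexOn ℝ G (φ i)) {c c' : ℝ}
    (hc : c < c') (h : ∀ w ∈ stdSimplex ℝ ι, ∃ g ∈ G, ∑ i, w i * φ i g ≤ c) :
    ∃ g ∈ G, ∀ i, φ i g ≤ c' := by
  classical
  by_contra! hcon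
  let S : Set (ι → ℝ) := {v | ∃ g ∈ G, ∀ i, φ i g < v i}
  have hSo : IsOpen S := by
    have : S = ⋃ g ∈ G, Set.pi Set.univ (fun i => Set.Ioi (φ i g)) := by
      ext v; simp [S]
    rw [this]
    exact isOpen_biUnion fun g _ => isOpen_set_pi Set.finite_univ fun i _ => isOpen_Ioi
  have hSv : Convex ℝ S := by
    rintro v ⟨g, hg, hv⟩ v' ⟨g', hg', hv'⟩ a b ha hb hab
    have hGv : ∀ i : ι, Convex ℝ G := fun i => (hφ i).1
    by_cases hι : Nonempty ι
    · refine ⟨a • g + b • g', hGv hι.some hg hg' ha hb hab, fun i => ?_⟩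
      refine ((hφ i).2 hg hg' ha hb hab).trans_lt ?_
      rcases ha.eq_or_lt with rfl | ha'
      · obtain rfl : b = 1 := by linarith
        simpa using hv' i
      · have h1 : a * φ i g < a * v i := mul_lt_mul_of_pos_left (hv i) ha'
        have h2 : b * φ i g' ≤ b * v' i := mul_le_mul_of_nonneg_left (hv' i).le hb
        simpa using add_lt_add_of_lt_of_le h1 h2
    · exact ⟨g, hg, fun i => (hι ⟨i⟩).elim⟩
  have hx : (fun _ => c') ∉ S := by
    rintro ⟨g, hg, hlt⟩
    obtain ⟨i, hi⟩ := hcon g hg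
    exact absurd (hlt i) hi.not_gt
  obtain ⟨l, hl⟩ := geometric_hahn_banach_open_point hSv hSo hx
  obtain ⟨g₀, hg₀⟩ := hG
  let d : ι → ℝ := fun i => -l (Pi.single i 1)
  have hlv : ∀ v : ι → ℝ, l v = -∑ i, d i * v i := by
    intro v
    conv_lhs => rw [pi_eq_sum_univ' v]
    simp [d, map_sum, mul_comm]
  have hmem : ∀ g ∈ G, ∀ s : ℝ, 0 < s → (fun i => φ i g + s) ∈ S :=
    fun g hg s hs => ⟨g, hg, fun i => by linarith⟩
  have hd : ∀ i, 0 ≤ d i := by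
    intro i
    by_contra! hneg
    let v : ι → ℝ := fun j => φ j g₀ + 1
    have hv : ∀ s : ℝ, 0 ≤ s → l v + s * l (Pi.single i 1) < l (fun _ => c') := by
      intro s hs
      have : v + s • Pi.single i (1 : ℝ) ∈ S := by
        refine ⟨g₀, hg₀, fun j => ?_⟩
        have : 0 ≤ (Pi.single i (1 : ℝ) : ι → ℝ) j := by
          by_cases hj : j = i
          · subst hj; simp
          · simp [hj]
        have := mul_nonneg hs this
        simp only [v, Pi.add_apply, Pi.smul_apply, smul_eq_mul]
        linarith
      simpa using hl _ this
    have hpos : 0 < l (Pi.single i 1) := by simpa [d] using hneg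
    have h0 := hv 0 le_rfl
    have h1 := hv ((l (fun _ => c') - l v) / l (Pi.single i 1))
      (div_nonneg (by linarith) hpos.le)
    rw [div_mul_cancel₀ _ hpos.ne'] at h1
    linarith
  have hsum : 0 < ∑ i, d i := by
    refine (Finset.sum_nonneg fun i _ => hd i).lt_of_ne fun h0 => ?_
    have hz : ∀ i, d i = 0 := fun i =>
      (Finset.sum_eq_zero_iff_of_nonneg fun i _ => hd i).1 h0.symm i (Finset.mem_univ i)
    have := hl _ (hmem g₀ hg₀ 1 one_pos)
    simp [hlv, hz] at this
  obtain ⟨g, hg, hgc⟩ := h (fun i => d i / ∑ j, d j)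
    ⟨fun i => div_nonneg (hd i) hsum.le, by rw [← Finset.sum_div, div_self hsum.ne']⟩
  have h1 := hl _ (hmem g hg (c' - c) (by linarith))
  rw [hlv, hlv, ← Finset.sum_mul] at h1
  have h2 : ∑ i, d i * (φ i g + (c' - c)) = ∑ i, d i * φ i g + (∑ i, d i) * (c' - c) := by
    simp_rw [mul_add, Finset.sum_add_distrib, ← Finset.sum_mul]
  have h3 : ∑ i, d i / (∑ j, d j) * φ i g = (∑ i, d i * φ i g) / ∑ j, d j := by
    rw [Finset.sum_div]
    exact Finset.sum_congr rfl fun i _ => by ring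
  rw [h3, div_le_iff₀ hsum] at hgc
  rw [h2] at h1
  nlinarith

/-- The set of square-integrable weights with values in `[0, 1]` giving `f` integral at most `c`. -/
def weightSet (P : Measure Ω) (f : Ω → ℝ) (c : ℝ) : Set (Lp ℝ 2 P) :=
  {g | (∀ᵐ ω ∂P, 0 ≤ g ω ∧ g ω ≤ 1) ∧ ∫ ω, g ω * f ω ∂P ≤ c}

theorem integrable_weight_mul {P : Measure Ω} {f g : Ω → ℝ} (hf : Integrable f P)
    (hgm : AEStronglyMeasurable g P) (hg : ∀ᵐ ω ∂P, 0 ≤ g ω ∧ g ω ≤ 1) :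
    Integrable (fun ω => g ω * f ω) P := by
  refine hf.mono (hgm.mul hf.1) ?_
  filter_upwards [hg] with ω h
  rw [norm_mul, Real.norm_of_nonneg h.1]
  exact mul_le_of_le_one_left (norm_nonneg _) h.2

theorem isClosed_weightSet (P : Measure Ω) {f : Ω → ℝ} (hf : Integrable f P)
    (c : ℝ) : IsClosed (weightSet P f c) := by
  refine IsSeqClosed.isClosed fun u g hu hug => ?_
  obtain ⟨ns, -, hns⟩ := (tendstoInMeasure_of_tendsto_Lp hug).exists_seq_tendsto_ae
  have h01 : ∀ᵐ ω ∂P, ∀ n, 0 ≤ u n ω ∧ u n ω ≤ 1 := ae_all_iff.2 fun n => (hu n).1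
  refine ⟨?_, ?_⟩
  · filter_upwards [hns, h01] with ω h1 h2
    exact ⟨ge_of_tendsto' h1 fun n => (h2 _).1, le_of_tendsto' h1 fun n => (h2 _).2⟩
  · have : Tendsto (fun n => ∫ ω, u (ns n) ω * f ω ∂P) atTop (nhds (∫ ω, g ω * f ω ∂P)) := by
      refine tendsto_integral_of_dominated_convergence (fun ω => ‖f ω‖)
        (fun n => (Lp.aestronglyMeasurable _).mul hf.1) hf.norm (fun n => ?_) ?_
      · filter_upwards [h01] with ω h
        rw [norm_mul, Real.norm_of_nonneg (h _).1]
        exact mul_le_of_le_one_left (norm_nonneg _) (h _).2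
      · filter_upwards [hns] with ω h
        exact h.mul_const _
    exact le_of_tendsto' this fun n => (hu _).2

theorem integral_combo_weight {P : Measure Ω} {f : Ω → ℝ} (hf : Integrable f P)
    {g g' : Lp ℝ 2 P} (hg : ∀ᵐ ω ∂P, 0 ≤ g ω ∧ g ω ≤ 1) (hg' : ∀ᵐ ω ∂P, 0 ≤ g' ω ∧ g' ω ≤ 1)
    (a b : ℝ) : ∫ ω, (a • g + b • g' : Lp ℝ 2 P) ω * f ω ∂P =
      a * ∫ ω, g ω * f ω ∂P + b * ∫ ω, g' ω * f ω ∂P := by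
  have h1 := integrable_weight_mul hf (Lp.aestronglyMeasurable g) hg
  have h2 := integrable_weight_mul hf (Lp.aestronglyMeasurable g') hg'
  rw [← integral_const_mul, ← integral_const_mul,
    ← integral_add (h1.const_mul a) (h2.const_mul b)]
  refine integral_congr_ae ?_
  filter_upwards [Lp.coeFn_add (a • g) (b • g'), Lp.coeFn_smul a g, Lp.coeFn_smul b g']
    with ω h1 h2 h3
  rw [h1, Pi.add_apply, h2, h3]
  simp only [Pi.smul_apply, smul_eq_mul]
  ring

theorem ae_mem_unitInterval_combo {P : Measure Ω} {g g' : Lp ℝ 2 P}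
    (hg : ∀ᵐ ω ∂P, 0 ≤ g ω ∧ g ω ≤ 1) (hg' : ∀ᵐ ω ∂P, 0 ≤ g' ω ∧ g' ω ≤ 1)
    {a b : ℝ} (ha : 0 ≤ a) (hb : 0 ≤ b) (hab : a + b = 1) :
    ∀ᵐ ω ∂P, 0 ≤ (a • g + b • g' : Lp ℝ 2 P) ω ∧ (a • g + b • g' : Lp ℝ 2 P) ω ≤ 1 := by
  filter_upwards [Lp.coeFn_add (a • g) (b • g'), Lp.coeFn_smul a g, Lp.coeFn_smul b g', hg, hg']
    with ω h1 h2 h3 h4 h5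
  rw [h1, Pi.add_apply, h2, h3]
  simp only [Pi.smul_apply, smul_eq_mul]
  constructor
  · have := mul_nonneg ha h4.1
    have := mul_nonneg hb h5.1
    linarith
  · have := mul_le_mul_of_nonneg_left h4.2 ha
    have := mul_le_mul_of_nonneg_left h5.2 hb
    linarith

theorem convex_weightSet (P : Measure Ω) {f : Ω → ℝ} (hf : Integrable f P) (c : ℝ) :
    Convex ℝ (weightSet P f c) := by
  rintro g ⟨hg, hgc⟩ g' ⟨hg', hgc'⟩ a b ha hb hab
  refine ⟨ae_mem_unitInterval_combo hg hg' ha hb hab, ?_⟩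
  rw [integral_combo_weight hf hg hg']
  have h1 := mul_le_mul_of_nonneg_left hgc ha
  have h2 := mul_le_mul_of_nonneg_left hgc' hb
  calc _ ≤ a * c + b * c := add_le_add h1 h2
    _ = c := by rw [← add_mul, hab, one_mul]

theorem isBounded_weightSet (P : Measure Ω) [IsProbabilityMeasure P] (f : Ω → ℝ) (c : ℝ) :
    Bornology.IsBounded (weightSet P f c) := by
  refine (isBounded_iff_forall_norm_le).2 ⟨_, fun g hg =>
    Lp.norm_le_of_ae_bound (f := g) zero_le_one (hg.1.mono fun ω h => ?_)⟩
  rw [Real.norm_of_nonneg h.1]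
  exact h.2

/-- Minimax for weights: if every member of a convex set of integrable functions has integral at
most `c` against some `[0, 1]`-valued weight of mass at least `1 - η`, then one such weight works
for all members simultaneously, at any level `c' > c`. -/
theorem exists_common_weight {P : Measure Ω} [IsProbabilityMeasure P] {D : Set (Ω → ℝ)}
    (hD : Convex ℝ D) (hint : ∀ f ∈ D, Integrable f P) {c c' η : ℝ} (hc : c < c') (hη : 0 ≤ η)
    (h : ∀ f ∈ D, ∃ g : Ω → ℝ, AEStronglyMeasurable g P ∧ (∀ᵐ ω ∂P, 0 ≤ g ω ∧ g ω ≤ 1) ∧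
      1 - η ≤ ∫ ω, g ω ∂P ∧ ∫ ω, g ω * f ω ∂P ≤ c) :
    ∃ g : Ω → ℝ, AEStronglyMeasurable g P ∧ (∀ᵐ ω ∂P, 0 ≤ g ω ∧ g ω ≤ 1) ∧
      1 - η ≤ ∫ ω, g ω ∂P ∧ ∀ f ∈ D, ∫ ω, g ω * f ω ∂P ≤ c' := by
  let G := weightSet P (fun _ => -1) (η - 1)
  have hm1 : Integrable (fun _ : Ω => (-1 : ℝ)) P := integrable_const _
  have hG : ∀ g : Lp ℝ 2 P, g ∈ G ↔ (∀ᵐ ω ∂P, 0 ≤ g ω ∧ g ω ≤ 1) ∧ 1 - η ≤ ∫ ω, g ω ∂P := by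
    intro g
    simp only [G, weightSet, Set.mem_ofPred_eq, mul_neg, mul_one, integral_neg]
    constructor <;> rintro ⟨h1, h2⟩ <;> exact ⟨h1, by linarith⟩
  have hlift : ∀ g : Ω → ℝ, AEStronglyMeasurable g P → (∀ᵐ ω ∂P, 0 ≤ g ω ∧ g ω ≤ 1) →
      1 - η ≤ ∫ ω, g ω ∂P → ∃ g' ∈ G, g' =ᵐ[P] g := by
    intro g hgm hg hgη
    have hL : MemLp g 2 P := MemLp.of_bound hgm 1 (hg.mono fun ω h => by
      rw [Real.norm_of_nonneg h.1]; exact h.2)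
    refine ⟨hL.toLp g, (hG _).2 ⟨?_, ?_⟩, hL.coeFn_toLp⟩
    · filter_upwards [hL.coeFn_toLp, hg] with ω h1 h2
      rwa [h1]
    · rwa [integral_congr_ae hL.coeFn_toLp]
  have hGne : G.Nonempty := by
    obtain ⟨g, hg, -⟩ := hlift (fun _ => 1) aestronglyMeasurable_const (by simp) (by simpa using hη)
    exact ⟨g, hg⟩
  have key : (G ∩ ⋂ f : D, weightSet P f c').Nonempty := by
    refine nonempty_iInter_of_isClosed_convex (isClosed_weightSet P hm1 _)
      (convex_weightSet P hm1 _) (isBounded_weightSet P _ _)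
      (fun f => isClosed_weightSet P (hint f f.2) _)
      (fun f => convex_weightSet P (hint f f.2) _) fun F => ?_
    obtain ⟨g, hg, hgF⟩ := exists_forall_le_of_convexOn (ι := F) hGne
      (φ := fun f g => ∫ ω, g ω * (f : D).1 ω ∂P) (fun f => ⟨convex_weightSet P hm1 _, by
        intro g hg g' hg' a b _ _ _
        exact (integral_combo_weight (hint _ f.1.2) ((hG g).1 hg).1 ((hG g').1 hg').1 a b).le⟩) hc
      (by
        intro w hw
        have hmem : ∑ f : F, w f • (f : D).1 ∈ D :=
          hD.sum_mem (fun f _ => hw.1 f) hw.2 fun f _ => f.1.2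
        obtain ⟨g, hgm, hg, hgη, hgc⟩ := h _ hmem
        obtain ⟨g', hg', hgg'⟩ := hlift g hgm hg hgη
        refine ⟨g', hg', le_of_eq_of_le ?_ hgc⟩
        simp_rw [← integral_const_mul]
        rw [← integral_finsetSum _ fun f _ => (integrable_weight_mul (hint _ f.1.2)
          (Lp.aestronglyMeasurable g') ((hG g').1 hg').1).const_mul _]
        refine integral_congr_ae ?_
        filter_upwards [hgg'] with ω hω
        simp only [hω, Finset.sum_apply, Pi.smul_apply, smul_eq_mul, Finset.mul_sum]
        exact Finset.sum_congr rfl fun f _ => by ring)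
    refine ⟨g, hg, ?_⟩
    simp only [Set.mem_iInter]
    exact fun f hf => ⟨((hG g).1 hg).1, hgF ⟨f, hf⟩⟩
  obtain ⟨g, hg, hgD⟩ := key
  simp only [Set.mem_iInter] at hgD
  exact ⟨g, Lp.aestronglyMeasurable g, ((hG g).1 hg).1, ((hG g).1 hg).2,
    fun f hf => (hgD ⟨f, hf⟩).2⟩

/-- The members of `K` that are `δ`-close to `X` in probability. -/
def nearSet (P : Measure Ω) (K : Set (Ω → ℝ)) (X : Ω → ℝ) (δ : ℝ) : Set (Ω → ℝ) :=
  {Z | Z ∈ K ∧ P {ω | δ ≤ |Z ω - X ω|} ≤ ENNReal.ofReal δ}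

theorem nearSet_mono (P : Measure Ω) (K : Set (Ω → ℝ)) (X : Ω → ℝ) {δ δ' : ℝ} (h : δ ≤ δ') :
    nearSet P K X δ ⊆ nearSet P K X δ' := fun _ hZ =>
  ⟨hZ.1, (measure_mono fun _ hω => h.trans hω).trans (hZ.2.trans (ENNReal.ofReal_le_ofReal h))⟩

theorem self_mem_nearSet (P : Measure Ω) {K : Set (Ω → ℝ)} {X : Ω → ℝ} (hX : X ∈ K) {δ : ℝ}
    (hδ : 0 < δ) : X ∈ nearSet P K X δ := by
  refine ⟨hX, ?_⟩
  simp [hδ.not_ge]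

theorem tendstoInMeasure_iff_eventually_nearSet {P : Measure Ω} {K : Set (Ω → ℝ)}
    {X : Ω → ℝ} {Z : ℕ → Ω → ℝ} (hZ : ∀ n, Z n ∈ K) :
    TendstoInMeasure P Z atTop X ↔ ∀ δ : ℝ, 0 < δ → ∀ᶠ n in atTop, Z n ∈ nearSet P K X δ := by
  rw [tendstoInMeasure_iff_norm]
  constructor
  · intro h δ hδ
    have := (ENNReal.tendsto_nhds_zero.1 (h δ hδ)) (ENNReal.ofReal δ) (by simpa using hδ)
    exact this.mono fun n hn => ⟨hZ n, hn⟩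
  · intro h ε hε
    refine ENNReal.tendsto_nhds_zero.2 fun r hr => ?_
    obtain ⟨s, hs0, hs⟩ : ∃ s : ℝ, 0 < s ∧ ENNReal.ofReal s ≤ r := by
      rcases eq_or_ne r ⊤ with rfl | hr'
      · exact ⟨1, one_pos, le_top⟩
      · exact ⟨r.toReal, ENNReal.toReal_pos hr.ne' hr', ENNReal.ofReal_toReal_le⟩
    refine (h (min ε s) (lt_min hε hs0)).mono fun n hn => ?_
    refine le_trans (measure_mono fun ω hω => ?_)
      (hn.2.trans ((ENNReal.ofReal_le_ofReal (min_le_right ε s)).trans hs))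
    exact (min_le_left ε s).trans hω

/-- Local convexity at `X`: convex hulls of small neighbourhoods of `X` are small. -/
theorem exists_convexHull_nearSet_subset {P : Measure Ω} {K : Set (Ω → ℝ)} {X : Ω → ℝ}
    (hK : Convex ℝ K) (hX : X ∈ K) (hloc : LocConvexAt P K X) {η : ℝ} (hη : 0 < η) :
    ∃ δ : ℝ, 0 < δ ∧ convexHull ℝ (nearSet P K X δ) ⊆ nearSet P K X η := by
  by_contra! hcon
  have hδ : ∀ m : ℕ, (0 : ℝ) < 1 / (m + 1) := fun m => Nat.one_div_pos_of_nat
  have hex : ∀ m : ℕ, ∃ t : Finset (Ω → ℝ), ↑t ⊆ nearSet P K X (1 / ((m : ℝ) + 1)) ∧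
      ∃ Y ∈ convexHull ℝ (t : Set (Ω → ℝ)), Y ∉ nearSet P K X η := by
    intro m
    obtain ⟨Y, hY, hYn⟩ := Set.not_subset.1 (hcon _ (hδ m))
    rw [convexHull_eq_union_convexHull_finite_subsets] at hY
    simp only [Set.mem_iUnion] at hY
    obtain ⟨t, ht, hYt⟩ := hY
    exact ⟨t, ht, Y, hYt, hYn⟩
  choose t ht Y hYt hYn using hex
  let Z : ℕ → Ω → ℝ := fun n => (t n.unpair.1).toList.getD n.unpair.2 X
  have hZnear : ∀ n, Z n ∈ nearSet P K X (1 / ((n.unpair.1 : ℝ) + 1)) := by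
    intro n
    by_cases hn : n.unpair.2 < (t n.unpair.1).toList.length
    · have h1 : Z n = (t n.unpair.1).toList[n.unpair.2] := List.getD_eq_getElem _ _ hn
      rw [h1]
      exact ht _ (Finset.mem_coe.2 (Finset.mem_toList.1 (List.getElem_mem hn)))
    · have h1 : Z n = X := List.getD_eq_default _ _ (not_lt.1 hn)
      rw [h1]
      exact self_mem_nearSet P hX (hδ _)
  have hZK : ∀ n, Z n ∈ K := fun n => (hZnear n).1
  have hZX : TendstoInMeasure P Z atTop X := by
    rw [tendstoInMeasure_iff_eventually_nearSet hZK]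
    intro δ hδ0
    obtain ⟨M, hM⟩ := exists_nat_one_div_lt hδ0
    rw [← Nat.cofinite_eq_atTop, Filter.eventually_cofinite]
    refine Set.Finite.subset (((Finset.range M).biUnion fun m =>
      (Finset.range (t m).toList.length).image fun j => Nat.pair m j).finite_toSet) fun n hn => ?_
    have hn1 : n.unpair.1 < M := by
      by_contra! hge
      refine hn (nearSet_mono P K X ?_ (hZnear n))
      exact (Nat.one_div_le_one_div hge).trans hM.le
    have hn2 : n.unpair.2 < (t n.unpair.1).toList.length := by
      by_contra! hge
      have h1 : Z n = X := List.getD_eq_default _ _ hge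
      refine hn ?_
      rw [h1]
      exact self_mem_nearSet P hX hδ0
    simp only [Finset.coe_biUnion, Finset.coe_image, Set.mem_iUnion, Finset.mem_coe,
      Finset.mem_range, Set.mem_image]
    exact ⟨_, hn1, _, hn2, Nat.pair_unpair n⟩
  have hFCC : IsFCC Z Y := by
    intro m
    refine convexHull_mono (fun z hz => ?_) (hYt m)
    obtain ⟨j, hj, rfl⟩ := List.getElem_of_mem (Finset.mem_toList.2 (Finset.mem_coe.1 hz))
    refine ⟨Nat.pair m j, Nat.left_le_pair m j, ?_⟩
    simp only [Z, Nat.unpair_pair]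
    exact List.getD_eq_getElem _ _ hj
  have hYK : ∀ m, Y m ∈ K := fun m =>
    convexHull_min (fun z hz => (ht m hz).1) hK (hYt m)
  obtain ⟨m, hm⟩ := ((tendstoInMeasure_iff_eventually_nearSet hYK).1
    (hloc Z hZK hZX Y hFCC) η hη).exists
  exact hYn m hm

/-- The negative part of `Z - X` is small in `L¹` when `Z ≥ 0` is close to `X` in probability. -/
theorem exists_integral_negPart_le {P : Measure Ω} [IsProbabilityMeasure P] {X : Ω → ℝ}
    (hX : Integrable X P) (hX0 : 0 ≤ᵐ[P] X) {η : ℝ} (hη : 0 < η) :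
    ∃ δ : ℝ, 0 < δ ∧ ∀ Z : Ω → ℝ, Integrable Z P → 0 ≤ᵐ[P] Z →
      P {ω | δ ≤ |Z ω - X ω|} ≤ ENNReal.ofReal δ → ∫ ω, max (X ω - Z ω) 0 ∂P ≤ η := by
  have hfin : ∫⁻ ω, ENNReal.ofReal (X ω) ∂P ≠ ⊤ := hX.lintegral_lt_top.ne
  obtain ⟨r, hr0, hr⟩ := exists_pos_setLIntegral_lt_of_measure_lt hfin
    (ε := ENNReal.ofReal (η / 2)) (by simpa using hη)
  obtain ⟨s, hs0, hs⟩ : ∃ s : ℝ, 0 < s ∧ ENNReal.ofReal s < r := by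
    obtain ⟨q, hq0, hq⟩ := ENNReal.lt_iff_exists_nnreal_btwn.1 hr0
    exact ⟨q, by exact_mod_cast hq0, by simpa using hq⟩
  refine ⟨min s (η / 2), lt_min hs0 (half_pos hη), fun Z hZ hZ0 hPZ => ?_⟩
  set δ := min s (η / 2)
  have hneg : Integrable (fun ω => max (X ω - Z ω) 0) P := (hX.sub hZ).pos_part
  set B := toMeasurable P {ω | δ ≤ |Z ω - X ω|}
  have hBm : MeasurableSet B := measurableSet_toMeasurable _ _
  have hPB : P B < r := by
    rw [measure_toMeasurable]
    exact (hPZ.trans (ENNReal.ofReal_le_ofReal (min_le_left _ _))).trans_lt hs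
  have hB1 : ∫ ω in B, X ω ∂P ≤ η / 2 := by
    rw [integral_eq_lintegral_of_nonneg_ae (ae_restrict_of_ae hX0) hX.1.restrict]
    exact ENNReal.toReal_le_of_le_ofReal (half_pos hη).le (hr B hPB).le
  calc ∫ ω, max (X ω - Z ω) 0 ∂P
      ≤ ∫ ω, (η / 2 + B.indicator X ω) ∂P := by
        refine integral_mono_ae hneg ((integrable_const _).add (hX.indicator hBm)) ?_
        filter_upwards [hX0, hZ0] with ω h1 h2
        simp only [Pi.zero_apply] at h1 h2
        by_cases hω : ω ∈ B
        · simp only [Set.indicator_of_mem hω]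
          exact max_le (by linarith) (by positivity)
        · have h3 : ¬ δ ≤ |Z ω - X ω| := fun h => hω (subset_toMeasurable _ _ h)
          have h4 : |Z ω - X ω| < η / 2 := (not_le.1 h3).trans_le (min_le_right _ _)
          simp only [Set.indicator_of_notMem hω, add_zero]
          exact max_le (by linarith [(abs_lt.1 h4).1]) (by positivity)
    _ = η / 2 + ∫ ω in B, X ω ∂P := by
        rw [integral_add (integrable_const _) (hX.indicator hBm), integral_indicator hBm]
        simp
    _ ≤ η := by linarith

/-- At a point of local convexity, some weight of almost full mass makes small neighbourhoods in
probability small in weighted `L¹`. -/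
theorem exists_local_weight {P : Measure Ω} [IsProbabilityMeasure P] {K : Set (Ω → ℝ)}
    {X : Ω → ℝ} (hK : Convex ℝ K) (hKint : ∀ Z ∈ K, Integrable Z P) (hK0 : ∀ Z ∈ K, 0 ≤ᵐ[P] Z)
    (hX : X ∈ K) (hloc : LocConvexAt P K X) {η : ℝ} (hη : 0 < η) :
    ∃ δ : ℝ, 0 < δ ∧ ∃ g : Ω → ENNReal, Measurable g ∧ (∀ ω, g ω ≤ 1) ∧
      ∫⁻ ω, (1 - g ω) ∂P ≤ ENNReal.ofReal η ∧
      ∀ Z ∈ nearSet P K X δ,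
        ∫⁻ ω, g ω * ENNReal.ofReal |Z ω - X ω| ∂P ≤ ENNReal.ofReal η := by
  set e := η / 4 with he
  have he0 : 0 < e := by positivity
  obtain ⟨δ₁, hδ₁, hsub⟩ := exists_convexHull_nearSet_subset hK hX hloc he0
  obtain ⟨δ₂, hδ₂, hneg⟩ := exists_integral_negPart_le (hKint X hX) (hK0 X hX) he0
  let D : Set (Ω → ℝ) := (fun f => f + X) ⁻¹' convexHull ℝ (nearSet P K X δ₁)
  have hDnear : ∀ f ∈ D, f + X ∈ nearSet P K X e := fun f hf => hsub hf
  have hDint : ∀ f ∈ D, Integrable f P := fun f hf => by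
    simpa using (hKint _ (hDnear f hf).1).sub (hKint X hX)
  obtain ⟨g, hgm, hg01, hgη, hgD⟩ := exists_common_weight (P := P) (D := D)
    ((convex_convexHull ℝ _).translate_preimage_left X) hDint (c := e) (c' := 2 * e) (η := e)
    (by linarith) he0.le (by
      intro f hf
      have hPf : P {ω | e ≤ |f ω|} ≤ ENNReal.ofReal e := by
        simpa using (hDnear f hf).2
      have hfm := (hDint f hf).1
      have hA : NullMeasurableSet {ω | e ≤ |f ω|} P :=
        nullMeasurableSet_le aemeasurable_const hfm.aemeasurable.abs
      have hgm : AEStronglyMeasurable ({ω | e ≤ |f ω|}ᶜ.indicator (fun _ => (1 : ℝ))) P :=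
        aestronglyMeasurable_const.indicator₀ hA.compl
      have hg01 : ∀ ω, 0 ≤ {ω | e ≤ |f ω|}ᶜ.indicator (fun _ => (1 : ℝ)) ω ∧
          {ω | e ≤ |f ω|}ᶜ.indicator (fun _ => (1 : ℝ)) ω ≤ 1 := fun ω =>
        ⟨Set.indicator_nonneg (fun _ _ => zero_le_one) _,
          Set.indicator_le_self' (fun _ _ => zero_le_one) _⟩
      refine ⟨_, hgm, Eventually.of_forall hg01, ?_, ?_⟩
      · rw [integral_indicator₀ hA.compl, setIntegral_const, smul_eq_mul, mul_one,
          measureReal_compl₀ hA, probReal_univ]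
        have : P.real {ω | e ≤ |f ω|} ≤ e := ENNReal.toReal_le_of_le_ofReal he0.le hPf
        linarith
      · have hle : ∀ ω, {ω | e ≤ |f ω|}ᶜ.indicator (fun _ => (1 : ℝ)) ω * f ω ≤ e := by
          intro ω
          by_cases hω : e ≤ |f ω|
          · simp [Set.indicator, hω, he0.le]
          · simp [Set.indicator, hω, (le_abs_self _).trans (not_le.1 hω).le]
        have := integral_mono (integrable_weight_mul (hDint f hf) hgm
          (Eventually.of_forall hg01)) (integrable_const e) hle
        simpa using this)
  have hgint : Integrable g P := by
    simpa using integrable_weight_mul (integrable_const (1 : ℝ)) hgm hg01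
  refine ⟨min δ₁ δ₂, lt_min hδ₁ hδ₂, fun ω => ENNReal.ofReal (min (hgm.mk g ω) 1), ?_, ?_, ?_, ?_⟩
  · exact (hgm.measurable_mk.min measurable_const).ennreal_ofReal
  · exact fun ω => by simp
  · have h1 : ∫⁻ ω, (1 - ENNReal.ofReal (min (hgm.mk g ω) 1)) ∂P =
        ENNReal.ofReal (∫ ω, (1 - g ω) ∂P) := by
      rw [ofReal_integral_eq_lintegral_ofReal (f := fun ω => 1 - g ω) ((integrable_const _).sub hgint)
        (hg01.mono fun ω h => by simpa using h.2)]
      refine lintegral_congr_ae ?_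
      filter_upwards [hgm.ae_eq_mk, hg01] with ω h1 h2
      rw [← h1, min_eq_left h2.2, ENNReal.ofReal_sub _ h2.1, ENNReal.ofReal_one]
    rw [h1, integral_sub (integrable_const _) hgint]
    refine ENNReal.ofReal_le_ofReal ?_
    simp only [integral_const, probReal_univ, smul_eq_mul, mul_one]
    linarith
  · intro Z hZ
    have hZK : Z ∈ K := hZ.1
    have hZint : Integrable (Z - X) P := (hKint Z hZK).sub (hKint X hX)
    have hZD : Z - X ∈ D := by
      rw [Set.mem_preimage, sub_add_cancel]
      exact subset_convexHull ℝ _ (nearSet_mono P K X (min_le_left _ _) hZ)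
    have hZabs : Integrable (fun ω => |Z ω - X ω|) P := hZint.abs
    have hb1 : ∫ ω, g ω * (Z - X) ω ∂P ≤ 2 * e := hgD _ hZD
    have hnint : Integrable (fun ω => max (X ω - Z ω) 0) P :=
      ((hKint X hX).sub (hKint Z hZK)).pos_part
    have hb2 : ∫ ω, max (X ω - Z ω) 0 ∂P ≤ e :=
      hneg Z (hKint Z hZK) (hK0 Z hZK) (nearSet_mono P K X (min_le_right _ _) hZ).2
    have h1 : ∫⁻ ω, ENNReal.ofReal (min (hgm.mk g ω) 1) * ENNReal.ofReal |Z ω - X ω| ∂P =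
        ENNReal.ofReal (∫ ω, g ω * |Z ω - X ω| ∂P) := by
      rw [ofReal_integral_eq_lintegral_ofReal (integrable_weight_mul hZabs hgm hg01)
        (hg01.mono fun ω h => mul_nonneg h.1 (abs_nonneg _))]
      refine lintegral_congr_ae ?_
      filter_upwards [hgm.ae_eq_mk, hg01] with ω h1 h2
      rw [← h1, min_eq_left h2.2, ENNReal.ofReal_mul h2.1]
    rw [h1]
    refine ENNReal.ofReal_le_ofReal ?_
    calc ∫ ω, g ω * |Z ω - X ω| ∂P
        ≤ ∫ ω, (g ω * (Z - X) ω + 2 * max (X ω - Z ω) 0) ∂P := by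
          refine integral_mono_ae (integrable_weight_mul hZabs hgm hg01)
            ((integrable_weight_mul hZint hgm hg01).add (hnint.const_mul 2)) ?_
          filter_upwards [hg01] with ω h
          simp only [Pi.sub_apply]
          rcases le_total (X ω) (Z ω) with h' | h'
          · rw [abs_of_nonneg (by linarith), max_eq_right (by linarith)]
            linarith
          · rw [abs_of_nonpos (by linarith), max_eq_left (by linarith)]
            nlinarith [h.1, h.2]
      _ = ∫ ω, g ω * (Z - X) ω ∂P + 2 * ∫ ω, max (X ω - Z ω) 0 ∂P := by
          rw [integral_add (integrable_weight_mul hZint hgm hg01) (hnint.const_mul 2),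
            integral_const_mul]
      _ ≤ η := by linarith

/-- A single bounded, almost everywhere positive density that upgrades convergence in probability
to weighted `L¹` convergence at countably many points of local convexity. -/
theorem exists_density {P : Measure Ω} [IsProbabilityMeasure P] {K : Set (Ω → ℝ)}
    (hK : Convex ℝ K) (hKint : ∀ Z ∈ K, Integrable Z P) (hK0 : ∀ Z ∈ K, 0 ≤ᵐ[P] Z)
    {C : ℝ} (hC : ∀ Z ∈ K, ∫ ω, |Z ω| ∂P ≤ C) {Y : ℕ → Ω → ℝ} (hY : ∀ N, Y N ∈ K)
    (hloc : ∀ N, LocConvexAt P K (Y N)) :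
    ∃ q : Ω → ENNReal, Measurable q ∧ (∀ ω, q ω ≤ 2) ∧ (∀ᵐ ω ∂P, 0 < q ω) ∧
      ∀ N, ∀ Z : ℕ → Ω → ℝ, (∀ n, Z n ∈ K) → TendstoInMeasure P Z atTop (Y N) →
        Tendsto (fun n => ∫⁻ ω, q ω * ENNReal.ofReal |Z n ω - Y N ω| ∂P) atTop (nhds 0) := by
  choose δ hδ g hgm hg1 hgη hgδ using fun j : ℕ =>
    exists_local_weight hK hKint hK0 (hY j.unpair.1) (hloc j.unpair.1)
      (η := (1 / 2 : ℝ) ^ j) (by positivity)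
  let r : ℕ → ENNReal := fun j => ((j : ENNReal) + 1)⁻¹
  have hr : Tendsto r atTop (nhds 0) := by
    refine tendsto_inv_iff.1 ?_
    simp only [r, inv_inv, ENNReal.inv_zero]
    exact tendsto_of_tendsto_of_tendsto_of_le_of_le ENNReal.tendsto_nat_nhds_top tendsto_const_nhds
      (fun j => le_self_add) (fun j => le_top)
  have hr0 : ∀ j, 0 < r j := fun j => ENNReal.inv_pos.2 (by finiteness)
  refine ⟨fun ω => ⨅ j, (g j ω + r j), Measurable.iInf fun j => (hgm j).add_const _, ?_, ?_, ?_⟩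
  · intro ω
    refine (iInf_le _ 0).trans ?_
    calc g 0 ω + r 0 ≤ 1 + 1 := add_le_add (hg1 0 ω) (by simp [r])
      _ = 2 := one_add_one_eq_two
  · have hsum : ∑' j, ∫⁻ ω, (1 - g j ω) ∂P ≠ ⊤ := by
      refine ne_top_of_le_ne_top ?_ (ENNReal.tsum_le_tsum hgη)
      exact summable_geometric_two.tsum_ofReal_ne_top
    have hm : ∀ j, Measurable fun ω => 1 - g j ω := fun j => measurable_const.sub (hgm j)
    rw [← lintegral_tsum fun j => (hm j).aemeasurable] at hsum
    have hae := ae_lt_top (Measurable.tsum hm) hsum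
    filter_upwards [hae] with ω hω
    have h0 := ENNReal.tendsto_atTop_zero_of_tsum_ne_top hω.ne
    obtain ⟨J, hJ⟩ := ((ENNReal.tendsto_nhds_zero.1 h0) 2⁻¹ (by simp)).exists_forall_of_atTop
    have hpos : (0 : ENNReal) < min 2⁻¹ (r J) := lt_min (by simp) (hr0 J)
    refine hpos.trans_le (le_iInf fun j => ?_)
    rcases le_total J j with hj | hj
    · refine (min_le_left _ _).trans (le_trans ?_ le_self_add)
      have h1 : (1 : ENNReal) ≤ 2⁻¹ + g j ω := tsub_le_iff_right.1 (hJ j hj)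
      rw [← ENNReal.inv_two_add_inv_two] at h1
      exact (ENNReal.add_le_add_iff_left (by simp)).1 h1
    · refine (min_le_right _ _).trans (le_trans ?_ le_add_self)
      exact ENNReal.inv_le_inv.2 (by gcongr)
  · intro N Z hZ hZY
    refine ENNReal.tendsto_nhds_zero.2 fun ε hε => ?_
    have hb : Tendsto (fun j : ℕ => ENNReal.ofReal ((1 / 2 : ℝ) ^ j) + r j * ENNReal.ofReal (2 * C))
        atTop (nhds 0) := by
      have h1 : Tendsto (fun j : ℕ => ENNReal.ofReal ((1 / 2 : ℝ) ^ j)) atTop (nhds 0) := by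
        simpa using ENNReal.tendsto_ofReal
          (tendsto_pow_atTop_nhds_zero_of_lt_one (r := (1 / 2 : ℝ)) (by norm_num) (by norm_num))
      have h2 := ENNReal.Tendsto.mul_const (b := ENNReal.ofReal (2 * C)) hr (Or.inr ENNReal.ofReal_ne_top)
      simpa only [zero_mul, add_zero] using h1.add h2
    obtain ⟨J, hJ⟩ := ((ENNReal.tendsto_nhds_zero.1 hb) ε hε).exists_forall_of_atTop
    set j := Nat.pair N J with hj
    have hjN : j.unpair.1 = N := by simp [hj]
    have hgj := hgδ j
    rw [hjN] at hgj
    filter_upwards [(tendstoInMeasure_iff_eventually_nearSet hZ).1 hZY (δ j) (hδ j)] with n hn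
    refine le_trans ?_ (hJ j (Nat.right_le_pair N J))
    have hint : Integrable (fun ω => |Z n ω - Y N ω|) P :=
      ((hKint _ (hZ n)).sub (hKint _ (hY N))).abs
    have hm : AEMeasurable (fun ω => ENNReal.ofReal |Z n ω - Y N ω|) P :=
      hint.1.aemeasurable.ennreal_ofReal
    calc ∫⁻ ω, (⨅ i, (g i ω + r i)) * ENNReal.ofReal |Z n ω - Y N ω| ∂P
        ≤ ∫⁻ ω, (g j ω * ENNReal.ofReal |Z n ω - Y N ω| +
            r j * ENNReal.ofReal |Z n ω - Y N ω|) ∂P := by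
          refine lintegral_mono fun ω => ?_
          rw [← add_mul]
          exact mul_le_mul_left (iInf_le _ j) _
      _ = ∫⁻ ω, g j ω * ENNReal.ofReal |Z n ω - Y N ω| ∂P +
            r j * ∫⁻ ω, ENNReal.ofReal |Z n ω - Y N ω| ∂P := by
          rw [lintegral_add_right' _ (hm.const_mul _), lintegral_const_mul'' _ hm]
      _ ≤ _ := by
          refine add_le_add (hgj _ hn) (mul_le_mul_right ?_ _)
          rw [← ofReal_integral_eq_lintegral_ofReal hint
            (Eventually.of_forall fun ω => abs_nonneg _)]
          refine ENNReal.ofReal_le_ofReal ?_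
          calc ∫ ω, |Z n ω - Y N ω| ∂P ≤ ∫ ω, (|Z n ω| + |Y N ω|) ∂P :=
                integral_mono hint ((hKint _ (hZ n)).abs.add (hKint _ (hY N)).abs)
                  fun ω => abs_sub _ _
            _ = ∫ ω, |Z n ω| ∂P + ∫ ω, |Y N ω| ∂P :=
                integral_add (hKint _ (hZ n)).abs (hKint _ (hY N)).abs
            _ ≤ 2 * C := by linarith [hC _ (hZ n), hC _ (hY N)]

/-- The average of the first `N + 1` terms of a sequence. -/
def initialAverage {E : Type*} [AddCommGroup E] [Module ℝ E] (x : ℕ → E) (N : ℕ) : E :=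
  ∑ i ∈ Finset.range (N + 1), (1 / ((N : ℝ) + 1)) • x i

theorem initialAverage_mem_convexHull {E : Type*} [AddCommGroup E] [Module ℝ E] (x : ℕ → E)
    (N : ℕ) : initialAverage x N ∈ convexHull ℝ (Set.range x) := by
  refine (convex_convexHull ℝ _).sum_mem (fun i _ => by positivity) ?_
    fun i _ => subset_convexHull ℝ _ (Set.mem_range_self i)
  have : (N : ℝ) + 1 ≠ 0 := by positivity
  simp [this]

/-- Every point of the convex hull of a sequence is the end of a segment in the hull that contains
one of the initial averages away from the other end. -/
theorem exists_initialAverage_eq_combo {E : Type*} [AddCommGroup E] [Module ℝ E] (x : ℕ → E)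
    {z : E} (hz : z ∈ convexHull ℝ (Set.range x)) :
    ∃ N : ℕ, ∃ t : ℝ, 0 < t ∧ t < 1 ∧ ∃ y ∈ convexHull ℝ (Set.range x),
      initialAverage x N = t • z + (1 - t) • y := by
  classical
  rw [convexHull_range_eq_exists_affineCombination] at hz
  obtain ⟨s, w, hw0, hw1, rfl⟩ := hz
  rw [s.affineCombination_eq_linear_combination _ _ hw1]
  set N := s.sup id
  have hsN : s ⊆ Finset.range (N + 1) := fun i hi =>
    Finset.mem_range.2 (Nat.lt_succ_of_le (Finset.le_sup (f := id) hi))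
  let v : ℕ → ℝ := fun i => if i ∈ s then w i else 0
  have hv0 : ∀ i, 0 ≤ v i := fun i => by
    by_cases hi : i ∈ s
    · simpa [v, hi] using hw0 i hi
    · simp [v, hi]
  have hv1 : ∑ i ∈ Finset.range (N + 1), v i = 1 := by
    rw [← hw1, ← Finset.sum_subset hsN fun i _ hi => by simp [v, hi]]
    exact Finset.sum_congr rfl fun i hi => by simp [v, hi]
  have hvx : ∑ i ∈ s, w i • x i = ∑ i ∈ Finset.range (N + 1), v i • x i := by
    rw [← Finset.sum_subset hsN fun i _ hi => by simp [v, hi]]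
    exact Finset.sum_congr rfl fun i hi => by simp [v, hi]
  have hvle : ∀ i ∈ Finset.range (N + 1), v i ≤ 1 := fun i hi =>
    hv1 ▸ Finset.single_le_sum (fun j _ => hv0 j) hi
  have hN : (0 : ℝ) < (N : ℝ) + 1 := by positivity
  set a : ℝ := 1 / ((N : ℝ) + 1) with ha
  have ha0 : 0 < a := by positivity
  have ha1 : a ≤ 1 := by
    rw [ha, div_le_one hN]
    linarith [Nat.cast_nonneg (α := ℝ) N]
  have hsa : ∑ i ∈ Finset.range (N + 1), a = 1 := by
    simp [ha, hN.ne']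
  have ht : (0 : ℝ) < 1 - a / 2 := by linarith
  refine ⟨N, a / 2, by positivity, by linarith,
    ∑ i ∈ Finset.range (N + 1), ((a - a / 2 * v i) / (1 - a / 2)) • x i, ?_, ?_⟩
  · refine (convex_convexHull ℝ _).sum_mem (fun i hi => div_nonneg ?_ ht.le) ?_
      fun i _ => subset_convexHull ℝ _ (Set.mem_range_self i)
    · nlinarith [hvle i hi]
    · rw [← Finset.sum_div, Finset.sum_sub_distrib, hsa, ← Finset.mul_sum, hv1, mul_one,
        div_self ht.ne']
  · rw [hvx, initialAverage, Finset.smul_sum, Finset.smul_sum, ← Finset.sum_add_distrib]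
    refine Finset.sum_congr rfl fun i _ => ?_
    rw [smul_smul, smul_smul, ← add_smul, mul_div_cancel₀ _ ht.ne']
    congr 1
    ring

theorem tendstoInMeasure_of_absolutelyContinuous {P Q : Measure Ω} [IsFiniteMeasure P]
    [IsFiniteMeasure Q] (hPQ : P ≪ Q) {Z : ℕ → Ω → ℝ} {X : Ω → ℝ}
    (h : TendstoInMeasure Q Z atTop X) : TendstoInMeasure P Z atTop X := by
  intro ε hε
  have := tendsto_setLIntegral_zero (μ := Q) (f := P.rnDeriv Q)
    (Measure.lintegral_rnDeriv_lt_top P Q).ne (h ε hε)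
  simpa only [Measure.setLIntegral_rnDeriv hPQ] using this

theorem tendstoInMeasure_of_tendsto_lintegral_abs {Q : Measure Ω} {Z : ℕ → Ω → ℝ} {X : Ω → ℝ}
    (hZ : ∀ n, AEStronglyMeasurable (Z n) Q) (hX : AEStronglyMeasurable X Q)
    (h : Tendsto (fun n => ∫⁻ ω, ENNReal.ofReal |Z n ω - X ω| ∂Q) atTop (nhds 0)) :
    TendstoInMeasure Q Z atTop X := by
  refine tendstoInMeasure_of_tendsto_eLpNorm one_ne_zero hZ hX ?_
  simpa only [eLpNorm_one_eq_lintegral_enorm, Pi.sub_apply, Real.enorm_eq_ofReal_abs] using h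

/-- Balls of `L¹(Q)` are convex. -/
theorem convex_setOf_lintegral_abs_sub_le {Q : Measure Ω} {K : Set (Ω → ℝ)} (hK : Convex ℝ K)
    (hKm : ∀ Z ∈ K, AEStronglyMeasurable Z Q) {X : Ω → ℝ} (hX : X ∈ K) (ε : ENNReal) :
    Convex ℝ {Z | Z ∈ K ∧ ∫⁻ ω, ENNReal.ofReal |Z ω - X ω| ∂Q ≤ ε} := by
  rintro Z ⟨hZ, hZε⟩ Z' ⟨hZ', hZε'⟩ a b ha hb hab
  refine ⟨hK hZ hZ' ha hb hab, ?_⟩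
  have hm : ∀ Z ∈ K, AEMeasurable (fun ω => ENNReal.ofReal |Z ω - X ω|) Q := fun Z hZ =>
    ((hKm Z hZ).sub (hKm X hX)).aemeasurable.abs.ennreal_ofReal
  calc ∫⁻ ω, ENNReal.ofReal |(a • Z + b • Z') ω - X ω| ∂Q
      ≤ ∫⁻ ω, (ENNReal.ofReal a * ENNReal.ofReal |Z ω - X ω| +
          ENNReal.ofReal b * ENNReal.ofReal |Z' ω - X ω|) ∂Q := by
        refine lintegral_mono fun ω => ?_
        rw [← ENNReal.ofReal_mul ha, ← ENNReal.ofReal_mul hb,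
          ← ENNReal.ofReal_add (by positivity) (by positivity)]
        refine ENNReal.ofReal_le_ofReal ?_
        have h1 : (a • Z + b • Z') ω - X ω = a * (Z ω - X ω) + b * (Z' ω - X ω) := by
          simp only [Pi.add_apply, Pi.smul_apply, smul_eq_mul]
          linear_combination X ω * hab
        rw [h1]
        refine (abs_add_le _ _).trans_eq ?_
        rw [abs_mul, abs_mul, abs_of_nonneg ha, abs_of_nonneg hb]
    _ = ENNReal.ofReal a * ∫⁻ ω, ENNReal.ofReal |Z ω - X ω| ∂Q +
          ENNReal.ofReal b * ∫⁻ ω, ENNReal.ofReal |Z' ω - X ω| ∂Q := by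
        rw [lintegral_add_left' ((hm Z hZ).const_mul _), lintegral_const_mul'' _ (hm Z hZ),
          lintegral_const_mul'' _ (hm Z' hZ')]
    _ ≤ ENNReal.ofReal a * ε + ENNReal.ofReal b * ε := by gcongr
    _ = ε := by rw [← add_mul, ← ENNReal.ofReal_add ha hb, hab, ENNReal.ofReal_one, one_mul]

theorem locConvexAt_of_topAgree {P Q : Measure Ω} {K : Set (Ω → ℝ)} (hK : Convex ℝ K)
    (hKm : ∀ Z ∈ K, AEStronglyMeasurable Z Q) (h : TopAgree P Q K) {X : Ω → ℝ} (hX : X ∈ K) :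
    LocConvexAt P K X := by
  intro Z hZ hZX W hW
  have hWK : ∀ k, W k ∈ K := fun k =>
    convexHull_min (by rintro _ ⟨n, -, rfl⟩; exact hZ n) hK (hW k)
  refine (h W X hWK hX).2 (ENNReal.tendsto_nhds_zero.2 fun ε hε => ?_)
  obtain ⟨M, hM⟩ := ((ENNReal.tendsto_nhds_zero.1
    ((h Z X hZ hX).1 hZX)) ε hε).exists_forall_of_atTop
  filter_upwards [eventually_ge_atTop M] with k hk
  refine (convexHull_min ?_ (convex_setOf_lintegral_abs_sub_le hK hKm hX ε) (hW k)).2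
  rintro _ ⟨n, hn, rfl⟩
  exact ⟨hZ n, hM n (hk.trans hn)⟩

theorem tendstoInMeasure_combo_const {P : Measure Ω} {Z : ℕ → Ω → ℝ} {X : Ω → ℝ}
    (h : TendstoInMeasure P Z atTop X) {t : ℝ} (ht : 0 < t) (V : Ω → ℝ) :
    TendstoInMeasure P (fun n => t • Z n + V) atTop (t • X + V) := by
  rw [tendstoInMeasure_iff_norm] at h ⊢
  intro ε hε
  have h1 := h (ε / t) (div_pos hε ht)
  refine h1.congr fun n => congrArg P (Set.ext fun ω => ?_)
  have h2 : (t • Z n + V) ω - (t • X + V) ω = t * (Z n ω - X ω) := by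
    simp only [Pi.add_apply, Pi.smul_apply, smul_eq_mul]
    ring
  simp only [Set.mem_ofPred_eq, h2, norm_mul, Real.norm_of_nonneg ht.le]
  rw [div_le_iff₀' ht]

/-- Normalizing a bounded, almost everywhere positive density gives an equivalent probability
measure. -/
theorem exists_equivProb_of_density {P : Measure Ω} [IsProbabilityMeasure P] {q : Ω → ENNReal}
    (hqm : Measurable q) (hq2 : ∀ ω, q ω ≤ 2) (hq0 : ∀ᵐ ω ∂P, 0 < q ω) :
    ∃ Q : Measure Ω, EquivProb P Q ∧ ∃ c : ENNReal, c ≠ ⊤ ∧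
      ∀ f : Ω → ENNReal, AEMeasurable f P → ∫⁻ ω, f ω ∂Q = c * ∫⁻ ω, q ω * f ω ∂P := by
  have hI0 : ∫⁻ ω, q ω ∂P ≠ 0 := by
    rw [Ne, lintegral_eq_zero_iff hqm]
    intro h
    obtain ⟨ω, h1, h2⟩ := (h.and hq0).exists
    exact h2.ne' h1
  have hI1 : ∫⁻ ω, q ω ∂P ≠ ⊤ := by
    refine ne_top_of_le_ne_top (b := 2) (by simp) ?_
    simpa using lintegral_mono (μ := P) hq2
  have hc0 : (∫⁻ ω, q ω ∂P)⁻¹ ≠ 0 := ENNReal.inv_ne_zero.2 hI1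
  refine ⟨(∫⁻ ω, q ω ∂P)⁻¹ • P.withDensity q, ⟨⟨?_⟩, ?_, ?_⟩, (∫⁻ ω, q ω ∂P)⁻¹,
    ENNReal.inv_ne_top.2 hI0, fun f hf => ?_⟩
  · rw [Measure.smul_apply, withDensity_apply _ MeasurableSet.univ, Measure.restrict_univ,
      smul_eq_mul, ENNReal.inv_mul_cancel hI0 hI1]
  · exact (withDensity_absolutelyContinuous P q).smul_left _
  · exact (withDensity_absolutelyContinuous' hqm.aemeasurable
      (hq0.mono fun ω h => h.ne')).trans (Measure.absolutelyContinuous_smul hc0)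
  · rw [lintegral_smul_measure, lintegral_withDensity_eq_lintegral_mul₀ hqm.aemeasurable hf,
      smul_eq_mul]
    rfl

/-- Theorem 1.6: for the convex hull of a bounded sequence in `L¹₊(P)`, local convexity of the
`L⁰(P)`-topology is equivalent to agreement of the `L⁰(Q)`- and `L¹(Q)`-topologies for some
equivalent `Q`. -/
theorem statement10 (P : Measure Ω) [IsProbabilityMeasure P]
    (Xs : ℕ → Ω → ℝ) (hint : ∀ n, Integrable (Xs n) P)
    (hpos : ∀ n, (0 : Ω → ℝ) ≤ᵐ[P] Xs n)
    (hbdd : ∃ C : ℝ, ∀ n, (∫ ω, |Xs n ω| ∂P) ≤ C) :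
    (∀ X ∈ convexHull ℝ (Set.range Xs), LocConvexAt P (convexHull ℝ (Set.range Xs)) X) ↔
      (∃ Q : Measure Ω, EquivProb P Q ∧ TopAgree P Q (convexHull ℝ (Set.range Xs))) := by
  have hK := convex_convexHull ℝ (Set.range Xs)
  set K := convexHull ℝ (Set.range Xs)
  have hKint : ∀ Z ∈ K, Integrable Z P := by
    refine fun Z hZ => convexHull_min (t := {Z | Integrable Z P}) ?_ ?_ hZ
    · rintro _ ⟨n, rfl⟩
      exact hint n
    · exact fun Z hZ Z' hZ' a b _ _ _ => (hZ.smul a).add (hZ'.smul b)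
  constructor
  · intro hloc
    obtain ⟨C, hC⟩ := hbdd
    have hK0 : ∀ Z ∈ K, 0 ≤ᵐ[P] Z := by
      refine fun Z hZ => convexHull_min (t := {Z | 0 ≤ᵐ[P] Z}) ?_ ?_ hZ
      · rintro _ ⟨n, rfl⟩
        exact hpos n
      · intro Z hZ Z' hZ' a b ha hb _
        have h1 : 0 ≤ᵐ[P] Z := hZ
        have h2 : 0 ≤ᵐ[P] Z' := hZ'
        change 0 ≤ᵐ[P] a • Z + b • Z'
        filter_upwards [h1, h2] with ω h1 h2
        exact add_nonneg (mul_nonneg ha h1) (mul_nonneg hb h2)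
    have hKC : ∀ Z ∈ K, ∫ ω, |Z ω| ∂P ≤ C := by
      refine fun Z hZ => (convexHull_min
        (t := {Z | Integrable Z P ∧ ∫ ω, |Z ω| ∂P ≤ C}) ?_ ?_ hZ).2
      · rintro _ ⟨n, rfl⟩
        exact ⟨hint n, hC n⟩
      · rintro Z ⟨hZ, hZC⟩ Z' ⟨hZ', hZC'⟩ a b ha hb hab
        have hi : Integrable (a • Z + b • Z') P := (hZ.smul a).add (hZ'.smul b)
        refine ⟨hi, ?_⟩
        calc ∫ ω, |(a • Z + b • Z') ω| ∂P ≤ ∫ ω, (a * |Z ω| + b * |Z' ω|) ∂P := by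
              refine integral_mono hi.abs ((hZ.abs.const_mul a).add (hZ'.abs.const_mul b))
                fun ω => (abs_add_le _ _).trans_eq ?_
              simp [abs_mul, abs_of_nonneg ha, abs_of_nonneg hb]
          _ = a * ∫ ω, |Z ω| ∂P + b * ∫ ω, |Z' ω| ∂P := by
              rw [integral_add (hZ.abs.const_mul a) (hZ'.abs.const_mul b), integral_const_mul,
                integral_const_mul]
          _ ≤ a * C + b * C := by gcongr
          _ = C := by rw [← add_mul, hab, one_mul]
    obtain ⟨q, hqm, hq2, hq0, hq⟩ := exists_density hK hKint hK0 hKC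
      (initialAverage_mem_convexHull Xs) fun N => hloc _ (initialAverage_mem_convexHull Xs N)
    obtain ⟨Q, hQ, c, hc, hcq⟩ := exists_equivProb_of_density hqm hq2 hq0
    refine ⟨Q, hQ, fun Z X hZ hX => ⟨fun hZX => ?_, fun hZX => ?_⟩⟩
    · obtain ⟨N, t, ht0, ht1, V, hV, hVN⟩ := exists_initialAverage_eq_combo Xs hX
      have hlim := tendstoInMeasure_combo_const hZX ht0 ((1 - t) • V)
      rw [← hVN] at hlim
      have hqlim := hq N _ (fun n => hK (hZ n) hV ht0.le (by linarith) (by ring)) hlim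
      have hm : ∀ n, AEMeasurable (fun ω => ENNReal.ofReal |Z n ω - X ω|) P := fun n =>
        ((hKint _ (hZ n)).sub (hKint X hX)).1.aemeasurable.abs.ennreal_ofReal
      have heq : ∀ n, ∫⁻ ω, ENNReal.ofReal |Z n ω - X ω| ∂Q = c * ((ENNReal.ofReal t)⁻¹ *
          ∫⁻ ω, q ω * ENNReal.ofReal
            |(t • Z n + (1 - t) • V) ω - initialAverage Xs N ω| ∂P) := by
        intro n
        rw [hcq _ (hm n), hVN]
        congr 1
        have h1 : ∀ ω, q ω * ENNReal.ofReal
            |(t • Z n + (1 - t) • V) ω - (t • X + (1 - t) • V) ω| =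
            ENNReal.ofReal t * (q ω * ENNReal.ofReal |Z n ω - X ω|) := by
          intro ω
          have h2 : (t • Z n + (1 - t) • V) ω - (t • X + (1 - t) • V) ω =
              t * (Z n ω - X ω) := by
            simp only [Pi.add_apply, Pi.smul_apply, smul_eq_mul]
            ring
          rw [h2, abs_mul, abs_of_pos ht0, ENNReal.ofReal_mul ht0.le]
          ring
        simp_rw [h1]
        rw [lintegral_const_mul' _ _ ENNReal.ofReal_ne_top, ← mul_assoc,
          ENNReal.inv_mul_cancel (by simpa using ht0) ENNReal.ofReal_ne_top, one_mul]
      simp_rw [heq]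
      have h3 := ENNReal.Tendsto.const_mul (a := (ENNReal.ofReal t)⁻¹) hqlim
        (Or.inr (ENNReal.inv_ne_top.2 (by simpa using ht0)))
      simpa using ENNReal.Tendsto.const_mul (a := c) h3 (Or.inr hc)
    · have := hQ.1
      exact tendstoInMeasure_of_absolutelyContinuous hQ.2.2
        (tendstoInMeasure_of_tendsto_lintegral_abs
          (fun n => (hKint _ (hZ n)).1.mono_ac hQ.2.1) ((hKint X hX).1.mono_ac hQ.2.1) hZX)
  · rintro ⟨Q, hQ, hagree⟩ X hX
    exact locConvexAt_of_topAgree hK (fun Z hZ => (hKint Z hZ).1.mono_ac hQ.2.1) hagree hX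

end Paper
end
end

section
/- Let (Ω,Σ,P) be a probability space and let (R_k)_{k≥1} be a sequence of P-integrable random variables with sup_k E_P[|R_k|] < ∞. Let L = { Σ_{k=1}^∞ a_k R_k : Σ_{k=1}^∞ |a_k| ≤ 1 } (series converging in L^1(P)). Then: (1) if for every sequence (V_m) with V_m in the convex hull of {R_k : k ≥ m} ∪ {−R_k : k ≥ m} one has V_m → 0 in P-probability, then for every ε > 0 there exists δ > 0 such that the convex hull of {G ∈ L : d(G,0) < δ} is contained in {Z : d(Z,0) < ε}; (2) if every forward convex combination of (|R_k|) converges to 0 in P-probability, then for every ε > 0 there exists δ > 0 such that the convex hull of the solid hull of {G ∈ L : d(G,0) < δ} is contained in {Z : d(Z,0) < ε}. -/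
open MeasureTheory Filter Set ProbabilityTheory

noncomputable section

namespace Paper

variable {Ω : Type*} [MeasurableSpace Ω]

/-- The Ky Fan type functional `E_P[min(|X|, 1)]`, that is, the distance `d(X, 0)`. -/
def probNorm (P : Measure Ω) (X : Ω → ℝ) : ℝ :=
  ∫ ω, min |X ω| 1 ∂P

/-- Real sequences whose `ℓ¹`-norm is at most `r`. -/
def l1Ball (r : ℝ) : Set (ℕ → ℝ) :=
  {b | ∀ n, ∑ k ∈ Finset.range n, |b k| ≤ r}

/-- The pointwise sum of the series `∑ b k * R k`. -/
def seriesSum (R : ℕ → Ω → ℝ) (b : ℕ → ℝ) : Ω → ℝ :=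
  fun ω => ∑' k, b k * R k ω

section ProbNorm

variable {P : Measure Ω}

theorem probDist_zero (X : Ω → ℝ) : probDist P X (fun _ => (0 : ℝ)) = probNorm P X := by
  simp [probDist, probNorm]

theorem probNorm_nonneg (X : Ω → ℝ) : 0 ≤ probNorm P X :=
  integral_nonneg fun _ => le_min (abs_nonneg _) zero_le_one

theorem aestronglyMeasurable_min_abs {X : Ω → ℝ} (hX : AEStronglyMeasurable X P) :
    AEStronglyMeasurable (fun ω => min |X ω| 1) P :=
  hX.norm.inf aestronglyMeasurable_const

theorem probNorm_congr {X Y : Ω → ℝ} (h : X =ᵐ[P] Y) : probNorm P X = probNorm P Y := by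
  refine integral_congr_ae ?_
  filter_upwards [h] with ω hω
  rw [hω]

variable [IsProbabilityMeasure P]

theorem integrable_min_abs {X : Ω → ℝ} (hX : AEStronglyMeasurable X P) :
    Integrable (fun ω => min |X ω| 1) P := by
  refine (integrable_const (1 : ℝ)).mono' (aestronglyMeasurable_min_abs hX) (ae_of_all _ fun ω => ?_)
  rw [Real.norm_of_nonneg (le_min (abs_nonneg _) zero_le_one)]
  exact min_le_right _ _

theorem probNorm_mono {X Y : Ω → ℝ} (hY : AEStronglyMeasurable Y P)
    (h : ∀ᵐ ω ∂P, |X ω| ≤ |Y ω|) : probNorm P X ≤ probNorm P Y := by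
  refine integral_mono_of_nonneg (ae_of_all _ fun ω => le_min (abs_nonneg _) zero_le_one)
    (integrable_min_abs hY) ?_
  filter_upwards [h] with ω hω using min_le_min_right _ hω

theorem probNorm_add_le {X Y : Ω → ℝ} (hX : AEStronglyMeasurable X P)
    (hY : AEStronglyMeasurable Y P) : probNorm P (X + Y) ≤ probNorm P X + probNorm P Y := by
  unfold probNorm
  rw [← integral_add (integrable_min_abs hX) (integrable_min_abs hY)]
  refine integral_mono (integrable_min_abs (hX.add hY))
    ((integrable_min_abs hX).add (integrable_min_abs hY)) fun ω => ?_
  have h := abs_add_le (X ω) (Y ω)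
  have h1 := abs_nonneg (X ω)
  have h2 := abs_nonneg (Y ω)
  simp only [Pi.add_apply]
  rcases min_cases |X ω| 1 with h3 | h3 <;> rcases min_cases |Y ω| 1 with h4 | h4 <;>
    rcases min_cases |X ω + Y ω| 1 with h5 | h5 <;> linarith

theorem probNorm_le_integral_abs {X : Ω → ℝ} (hX : Integrable X P) :
    probNorm P X ≤ ∫ ω, |X ω| ∂P :=
  integral_mono (integrable_min_abs hX.1) hX.abs fun _ => min_le_left _ _

theorem ae_eq_zero_of_probNorm_eq_zero {X : Ω → ℝ} (hX : AEStronglyMeasurable X P)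
    (h : probNorm P X = 0) : X =ᵐ[P] 0 := by
  have h0 := (integral_eq_zero_iff_of_nonneg
    (fun ω => le_min (abs_nonneg (X ω)) zero_le_one) (integrable_min_abs hX)).1 h
  filter_upwards [h0] with ω hω
  simp only [Pi.zero_apply] at hω ⊢
  rcases min_cases |X ω| 1 with h3 | h3
  · exact abs_eq_zero.1 (h3.1.symm.trans hω)
  · linarith [h3.1]

theorem tendsto_probNorm {X : ℕ → Ω → ℝ} {Y : Ω → ℝ} (hX : ∀ n, AEStronglyMeasurable (X n) P)
    (h : ∀ᵐ ω ∂P, Tendsto (fun n => X n ω) atTop (nhds (Y ω))) :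
    Tendsto (fun n => probNorm P (X n)) atTop (nhds (probNorm P Y)) := by
  refine tendsto_integral_filter_of_norm_le_const
    (Eventually.of_forall fun n => aestronglyMeasurable_min_abs (hX n))
    ⟨1, Eventually.of_forall fun n => ae_of_all _ fun ω => ?_⟩ ?_
  · rw [Real.norm_of_nonneg (le_min (abs_nonneg _) zero_le_one)]
    exact min_le_right _ _
  · filter_upwards [h] with ω hω using hω.abs.min tendsto_const_nhds

/-- If every selection from the sets `A m` tends to `0` in probability, the sets `A m` are
eventually small, uniformly. -/
theorem exists_forall_mem_probNorm_le {A : ℕ → Set (Ω → ℝ)}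
    (hA : ∀ m, ∀ V ∈ A m, AEStronglyMeasurable V P)
    (h : ∀ V : ℕ → Ω → ℝ, (∀ m, V m ∈ A m) → TendstoInMeasure P V atTop (fun _ => (0 : ℝ)))
    {ε : ℝ} (hε : 0 < ε) : ∃ m, ∀ V ∈ A m, probNorm P V ≤ ε := by
  by_contra! hcon
  choose V hV hVε using hcon
  obtain ⟨ns, -, hns⟩ := (h V hV).exists_seq_tendsto_ae
  have h0 : Tendsto (fun n => probNorm P (V (ns n))) atTop (nhds (probNorm P fun _ => (0 : ℝ))) :=
    tendsto_probNorm (fun n => hA _ _ (hV _)) hns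
  have h1 := ge_of_tendsto' h0 fun n => (hVε (ns n)).le
  simp [probNorm] at h1
  linarith

end ProbNorm

section L1Ball

theorem summable_abs_of_mem_l1Ball {r : ℝ} {b : ℕ → ℝ} (hb : b ∈ l1Ball r) :
    Summable fun k => |b k| :=
  summable_of_sum_range_le (fun _ => abs_nonneg _) hb

theorem abs_le_of_mem_l1Ball {r : ℝ} {b : ℕ → ℝ} (hb : b ∈ l1Ball r) (k : ℕ) : |b k| ≤ r :=
  (Finset.single_le_sum (f := fun k => |b k|) (fun _ _ => abs_nonneg _)
    (Finset.self_mem_range_succ k)).trans (hb (k + 1))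

theorem l1Ball_of_abs_le {r : ℝ} {b c : ℕ → ℝ} (hb : b ∈ l1Ball r) (h : ∀ k, |c k| ≤ |b k|) :
    c ∈ l1Ball r :=
  fun n => (Finset.sum_le_sum fun k _ => h k).trans (hb n)

theorem sub_mem_l1Ball {r s : ℝ} {b c : ℕ → ℝ} (hb : b ∈ l1Ball r) (hc : c ∈ l1Ball s) :
    b - c ∈ l1Ball (r + s) := fun n => by
  refine (Finset.sum_le_sum fun k _ => abs_sub (b k) (c k)).trans ?_
  rw [Finset.sum_add_distrib]
  exact add_le_add (hb n) (hc n)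

theorem smul_mem_l1Ball {r : ℝ} {b : ℕ → ℝ} (hb : b ∈ l1Ball r) (t : ℝ) :
    t • b ∈ l1Ball (|t| * r) := fun n => by
  simp only [Pi.smul_apply, smul_eq_mul, abs_mul, ← Finset.mul_sum]
  exact mul_le_mul_of_nonneg_left (hb n) (abs_nonneg t)

theorem convex_abs_le (k : ℕ) (r : ℝ) : Convex ℝ {b : ℕ → ℝ | |b k| ≤ r} := by
  intro b hb c hc s t hs ht hst
  simp only [Set.mem_ofPred_eq, Pi.add_apply, Pi.smul_apply, smul_eq_mul] at *
  calc |s * b k + t * c k| ≤ s * |b k| + t * |c k| := by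
        refine (abs_add_le _ _).trans ?_
        rw [abs_mul, abs_mul, abs_of_nonneg hs, abs_of_nonneg ht]
    _ ≤ s * r + t * r := by gcongr
    _ = r := by rw [← add_mul, hst, one_mul]

theorem convex_l1Ball (r : ℝ) : Convex ℝ (l1Ball r) := by
  intro b hb c hc s t hs ht hst n
  calc ∑ k ∈ Finset.range n, |(s • b + t • c) k|
      ≤ ∑ k ∈ Finset.range n, (s * |b k| + t * |c k|) := by
        refine Finset.sum_le_sum fun k _ => (abs_add_le _ _).trans ?_
        simp [abs_mul, abs_of_nonneg hs, abs_of_nonneg ht]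
    _ = s * ∑ k ∈ Finset.range n, |b k| + t * ∑ k ∈ Finset.range n, |c k| := by
        rw [Finset.sum_add_distrib, Finset.mul_sum, Finset.mul_sum]
    _ ≤ s * r + t * r := by
        gcongr
        exacts [hb n, hc n]
    _ = r := by rw [← add_mul, hst, one_mul]

theorem isCompact_l1Ball (r : ℝ) : IsCompact (l1Ball r) := by
  have hc : IsClosed (l1Ball r) := by
    simp only [l1Ball, Set.ofPred_forall]
    refine isClosed_iInter fun n => isClosed_le ?_ continuous_const
    fun_prop
  refine (isCompact_univ_pi fun _ : ℕ => isCompact_Icc (a := -r) (b := r)).of_isClosed_subset hc ?_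
  intro b hb k _
  exact abs_le.1 (abs_le_of_mem_l1Ball hb k)

omit [MeasurableSpace Ω] in
theorem mem_Lset_iff {R : ℕ → Ω → ℝ} {G : Ω → ℝ} :
    G ∈ Lset R ↔ ∃ a ∈ l1Ball 1, G = seriesSum R a := by
  constructor
  · rintro ⟨a, ha, ha1, rfl⟩
    exact ⟨a, fun n => (ha.sum_le_tsum _ fun _ _ => abs_nonneg _).trans ha1, rfl⟩
  · rintro ⟨a, ha, rfl⟩
    exact ⟨a, summable_abs_of_mem_l1Ball ha,
      Real.tsum_le_of_sum_range_le (fun _ => abs_nonneg _) ha, rfl⟩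

end L1Ball

section SeriesSum

variable {P : Measure Ω} {R : ℕ → Ω → ℝ} {C : ℝ}

theorem ae_summable_mul (hint : ∀ j, Integrable (R j) P) (hC : ∀ j, (∫ ω, |R j ω| ∂P) ≤ C)
    {b : ℕ → ℝ} (hb : Summable fun k => |b k|) :
    ∀ᵐ ω ∂P, Summable fun k => b k * R k ω := by
  have hs : Summable fun k => |b k| * C := hb.mul_right C
  have key : ∀ᵐ ω ∂P, Summable fun k => ‖b k * R k ω‖ := by
    refine summable_norm_of_tsum_eLpNorm_ne_top le_rfl (f := fun k ω => b k * R k ω)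
      (fun k => (hint k).1.const_mul _) ?_
    refine ne_top_of_le_ne_top hs.tsum_ofReal_ne_top (ENNReal.tsum_le_tsum fun k => ?_)
    rw [eLpNorm_one_eq_lintegral_enorm, ← ofReal_integral_norm_eq_lintegral_enorm
      ((hint k).const_mul (b k))]
    refine ENNReal.ofReal_le_ofReal ?_
    simp only [norm_mul, Real.norm_eq_abs, integral_const_mul]
    exact mul_le_mul_of_nonneg_left (hC k) (abs_nonneg _)
  filter_upwards [key] with ω hω using hω.of_norm

theorem ae_tendsto_seriesSum (hint : ∀ j, Integrable (R j) P)
    (hC : ∀ j, (∫ ω, |R j ω| ∂P) ≤ C) {b : ℕ → ℝ} (hb : Summable fun k => |b k|) :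
    ∀ᵐ ω ∂P, Tendsto (fun n => (∑ k ∈ Finset.range n, b k • R k) ω) atTop
      (nhds (seriesSum R b ω)) := by
  filter_upwards [ae_summable_mul hint hC hb] with ω hω
  simpa [seriesSum] using hω.hasSum.tendsto_sum_nat

theorem integrable_partialSum (hint : ∀ j, Integrable (R j) P) (b : ℕ → ℝ) (n : ℕ) :
    Integrable (∑ k ∈ Finset.range n, b k • R k) P :=
  integrable_finsetSum' _ fun k _ => (hint k).smul (b k)

theorem aestronglyMeasurable_seriesSum (hint : ∀ j, Integrable (R j) P)
    (hC : ∀ j, (∫ ω, |R j ω| ∂P) ≤ C) {b : ℕ → ℝ} (hb : Summable fun k => |b k|) :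
    AEStronglyMeasurable (seriesSum R b) P :=
  aestronglyMeasurable_of_tendsto_ae atTop (fun n => (integrable_partialSum hint b n).1)
    (ae_tendsto_seriesSum hint hC hb)

omit [MeasurableSpace Ω] in
theorem seriesSum_smul (t : ℝ) (b : ℕ → ℝ) : seriesSum R (t • b) = t • seriesSum R b := by
  ext ω
  simp [seriesSum, mul_assoc, tsum_mul_left]

theorem seriesSum_add (hint : ∀ j, Integrable (R j) P) (hC : ∀ j, (∫ ω, |R j ω| ∂P) ≤ C)
    {b c : ℕ → ℝ} (hb : Summable fun k => |b k|) (hc : Summable fun k => |c k|) :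
    seriesSum R (b + c) =ᵐ[P] seriesSum R b + seriesSum R c := by
  filter_upwards [ae_summable_mul hint hC hb, ae_summable_mul hint hC hc] with ω h1 h2
  simp only [seriesSum, Pi.add_apply, add_mul]
  exact h1.tsum_add h2

theorem seriesSum_sub (hint : ∀ j, Integrable (R j) P) (hC : ∀ j, (∫ ω, |R j ω| ∂P) ≤ C)
    {b c : ℕ → ℝ} (hb : Summable fun k => |b k|) (hc : Summable fun k => |c k|) :
    seriesSum R (b - c) =ᵐ[P] seriesSum R b - seriesSum R c := by
  filter_upwards [ae_summable_mul hint hC hb, ae_summable_mul hint hC hc] with ω h1 h2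
  simp only [seriesSum, Pi.sub_apply, sub_mul]
  exact h1.tsum_sub h2

theorem seriesSum_combo (hint : ∀ j, Integrable (R j) P)
    (hC : ∀ j, (∫ ω, |R j ω| ∂P) ≤ C) {b c : ℕ → ℝ} (hb : Summable fun k => |b k|)
    (hc : Summable fun k => |c k|) (s t : ℝ) :
    seriesSum R (s • b + t • c) =ᵐ[P] s • seriesSum R b + t • seriesSum R c := by
  have habs : ∀ (r : ℝ) {d : ℕ → ℝ}, (Summable fun k => |d k|) →
      Summable fun k => |(r • d) k| := fun r d hd => by
    simpa [abs_mul] using hd.mul_left |r|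
  have h := seriesSum_add hint hC (habs s hb) (habs t hc)
  rwa [seriesSum_smul, seriesSum_smul] at h

theorem abs_seriesSum_le (hint : ∀ j, Integrable (R j) P)
    (hC : ∀ j, (∫ ω, |R j ω| ∂P) ≤ C) {b : ℕ → ℝ} (hb : Summable fun k => |b k|) :
    ∀ᵐ ω ∂P, |seriesSum R b ω| ≤ seriesSum (fun j ω => |R j ω|) (fun k => |b k|) ω := by
  have hs := ae_summable_mul (P := P) (R := fun j ω => |R j ω|) (C := C) (b := fun k => |b k|)
    (fun j => (hint j).abs) (fun j => by simpa only [abs_abs] using hC j)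
    (by simpa only [abs_abs] using hb)
  filter_upwards [hs] with ω hω
  have h : Summable fun k => ‖b k * R k ω‖ := by
    simpa only [Real.norm_eq_abs, abs_mul] using hω
  have h1 := norm_tsum_le_tsum_norm h
  simp only [Real.norm_eq_abs, abs_mul] at h1
  exact h1

theorem sum_smul_mem_of_zero_mem {E : Type*} [AddCommGroup E] [Module ℝ E] {S : Set E}
    (hS : Convex ℝ S) (h0 : (0 : E) ∈ S) {ι : Type*} {t : Finset ι} {w : ι → ℝ} {z : ι → E}
    (hw : ∀ i ∈ t, 0 ≤ w i) (hw1 : ∑ i ∈ t, w i ≤ 1) (hz : ∀ i ∈ t, z i ∈ S) :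
    ∑ i ∈ t, w i • z i ∈ S := by
  have h := hS.sum_mem (t := t.insertNone) (w := fun o => o.elim (1 - ∑ i ∈ t, w i) w)
    (z := fun o => o.elim 0 z) ?_ ?_ ?_
  · simpa [Finset.sum_insertNone] using h
  · rintro (_ | i) hi
    · simpa using hw1
    · exact hw i (by simpa using hi)
  · simp [Finset.sum_insertNone]
  · rintro (_ | i) hi
    · exact h0
    · exact hz i (by simpa using hi)

/-- The convex hull of `{R j : j ≥ m} ∪ {-R j : j ≥ m}`. -/
def symmHull (R : ℕ → Ω → ℝ) (m : ℕ) : Set (Ω → ℝ) :=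
  convexHull ℝ ((R '' {j | m ≤ j}) ∪ ((fun j => -R j) '' {j | m ≤ j}))

omit [MeasurableSpace Ω] in
theorem zero_mem_symmHull (R : ℕ → Ω → ℝ) (m : ℕ) : (0 : Ω → ℝ) ∈ symmHull R m := by
  have h := convex_convexHull ℝ ((R '' {j | m ≤ j}) ∪ ((fun j => -R j) '' {j | m ≤ j}))
    (subset_convexHull ℝ _ (Or.inl ⟨m, le_refl m, rfl⟩))
    (subset_convexHull ℝ _ (Or.inr ⟨m, le_refl m, rfl⟩))
    (show (0 : ℝ) ≤ 2⁻¹ by norm_num) (show (0 : ℝ) ≤ 2⁻¹ by norm_num) (by norm_num)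
  simpa [symmHull] using h

theorem integrable_of_mem_symmHull (hint : ∀ j, Integrable (R j) P) {m : ℕ} {V : Ω → ℝ}
    (hV : V ∈ symmHull R m) : Integrable V P := by
  refine convexHull_min (t := {V | Integrable V P}) ?_ ?_ hV
  · rintro _ (⟨j, -, rfl⟩ | ⟨j, -, rfl⟩)
    exacts [hint j, (hint j).neg]
  · intro X hX Y hY s t _ _ _
    exact (Integrable.smul s hX).add (Integrable.smul t hY)

omit [MeasurableSpace Ω] in
theorem partialSum_mem_symmHull {b : ℕ → ℝ} (hb : b ∈ l1Ball 1) {m : ℕ}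
    (hm : ∀ k < m, b k = 0) (n : ℕ) :
    ∑ k ∈ Finset.range n, b k • R k ∈ symmHull R m := by
  have hsign : ∀ k, b k • R k = |b k| • (if k < m then 0 else if 0 ≤ b k then R k else -R k) := by
    intro k
    split_ifs with h1 h2
    · simp [hm k h1]
    · rw [abs_of_nonneg h2]
    · rw [abs_of_neg (not_le.1 h2), smul_neg, neg_smul, neg_neg]
  simp only [hsign]
  refine sum_smul_mem_of_zero_mem (convex_convexHull ℝ _) (zero_mem_symmHull R m)
    (fun k _ => abs_nonneg _) (hb n) fun k _ => ?_
  split_ifs with h1 h2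
  · exact zero_mem_symmHull R m
  · exact subset_convexHull ℝ _ (Or.inl ⟨k, not_lt.1 h1, rfl⟩)
  · exact subset_convexHull ℝ _ (Or.inr ⟨k, not_lt.1 h1, rfl⟩)

omit [MeasurableSpace Ω] in
/-- An element of the symmetric hull of either `R` or `|R|` is dominated by a convex combination
of the `|R j|`. -/
theorem symmHull_dominated {S : ℕ → Ω → ℝ} (hS : ∀ j ω, |S j ω| ≤ |R j ω|) {m : ℕ} {V : Ω → ℝ}
    (hV : V ∈ symmHull S m) :
    ∃ W ∈ convexHull ℝ ((fun j ω => |R j ω|) '' {n | m ≤ n}), ∀ ω, |V ω| ≤ W ω := by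
  refine convexHull_min (t := {V : Ω → ℝ |
    ∃ W ∈ convexHull ℝ ((fun j ω => |R j ω|) '' {n | m ≤ n}), ∀ ω, |V ω| ≤ W ω}) ?_ ?_ hV
  · rintro _ (⟨j, hj, rfl⟩ | ⟨j, hj, rfl⟩)
    · exact ⟨_, subset_convexHull ℝ _ ⟨j, hj, rfl⟩, hS j⟩
    · exact ⟨_, subset_convexHull ℝ _ ⟨j, hj, rfl⟩, fun ω => by simpa using hS j ω⟩
  · rintro X ⟨W, hW, hXW⟩ Y ⟨W', hW', hYW⟩ s t hs ht hst
    refine ⟨_, convex_convexHull ℝ _ hW hW' hs ht hst, fun ω => (abs_add_le _ _).trans ?_⟩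
    simp only [Pi.add_apply, Pi.smul_apply, smul_eq_mul, abs_mul, abs_of_nonneg hs,
      abs_of_nonneg ht]
    gcongr
    exacts [hXW ω, hYW ω]

theorem tendstoInMeasure_symmHull_of_isFCC
    (hW : ∀ W : ℕ → Ω → ℝ, IsFCC (fun j ω => |R j ω|) W →
      TendstoInMeasure P W atTop (fun _ => (0 : ℝ)))
    {S : ℕ → Ω → ℝ} (hS : ∀ j ω, |S j ω| ≤ |R j ω|) (V : ℕ → Ω → ℝ)
    (hV : ∀ m, V m ∈ symmHull S m) : TendstoInMeasure P V atTop (fun _ => (0 : ℝ)) := by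
  choose W hWmem hVW using fun m => symmHull_dominated hS (hV m)
  intro ε hε
  refine tendsto_of_tendsto_of_tendsto_of_le_of_le tendsto_const_nhds (hW W hWmem ε hε)
    (fun _ => zero_le) fun m => measure_mono fun ω hω => ?_
  refine le_trans (Set.mem_ofPred_eq ▸ hω) ?_
  rw [edist_dist, edist_dist]
  refine ENNReal.ofReal_le_ofReal ?_
  simpa [Real.dist_eq] using (hVW m ω).trans (le_abs_self _)

variable [IsProbabilityMeasure P]

/-- Splitting a series at `m`: the first `m` terms are controlled in `L¹`, the remaining ones
by a uniform bound on tails with coefficients of `ℓ¹`-norm at most one. -/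
theorem probNorm_seriesSum_le (hint : ∀ j, Integrable (R j) P)
    (hC : ∀ j, (∫ ω, |R j ω| ∂P) ≤ C) {m : ℕ} {ε : ℝ}
    (htail : ∀ b ∈ l1Ball 1, (∀ k < m, b k = 0) → probNorm P (seriesSum R b) ≤ ε)
    {b : ℕ → ℝ} (hb : b ∈ l1Ball 2) :
    probNorm P (seriesSum R b) ≤ (∑ k ∈ Finset.range m, |b k|) * C + 2 * ε := by
  set c : ℕ → ℝ := fun k => if k < m then 0 else 2⁻¹ * b k with hc
  have hcb : c ∈ l1Ball 1 := by
    have h := smul_mem_l1Ball hb 2⁻¹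
    norm_num at h
    refine l1Ball_of_abs_le h fun k => ?_
    by_cases hk : k < m
    · simp [hc, hk]
    · simp [hc, hk]
  have hc0 : ∀ k < m, c k = 0 := fun k hk => by simp [hc, hk]
  have hcs := summable_abs_of_mem_l1Ball hcb
  have hmeas := aestronglyMeasurable_seriesSum hint hC hcs
  have hsplit : seriesSum R b =ᵐ[P]
      (∑ k ∈ Finset.range m, b k • R k) + (seriesSum R c + seriesSum R c) := by
    filter_upwards [ae_summable_mul hint hC (summable_abs_of_mem_l1Ball hb),
      ae_summable_mul hint hC hcs] with ω h1 h2
    simp only [seriesSum, Pi.add_apply, Finset.sum_apply, Pi.smul_apply, smul_eq_mul]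
    rw [← h1.sum_add_tsum_nat_add m, ← h2.sum_add_tsum_nat_add m, ← two_mul, mul_add]
    rw [Finset.sum_eq_zero (s := Finset.range m) (f := fun k => c k * R k ω)
      fun k hk => by rw [hc0 k (Finset.mem_range.1 hk), zero_mul]]
    rw [mul_zero, zero_add, ← tsum_mul_left]
    congr 1
    refine tsum_congr fun k => ?_
    simp [hc]
    ring
  have hhead : probNorm P (∑ k ∈ Finset.range m, b k • R k) ≤
      (∑ k ∈ Finset.range m, |b k|) * C := by
    refine (probNorm_le_integral_abs (integrable_partialSum hint b m)).trans ?_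
    calc ∫ ω, |(∑ k ∈ Finset.range m, b k • R k) ω| ∂P
        ≤ ∫ ω, ∑ k ∈ Finset.range m, |b k| * |R k ω| ∂P := by
          refine integral_mono (integrable_partialSum hint b m).abs
            (integrable_finsetSum _ fun k _ => (hint k).abs.const_mul _) fun ω => ?_
          simp only [Finset.sum_apply, Pi.smul_apply, smul_eq_mul, ← abs_mul]
          exact Finset.abs_sum_le_sum_abs _ _
      _ = ∑ k ∈ Finset.range m, |b k| * ∫ ω, |R k ω| ∂P := by
          rw [integral_finsetSum _ fun k _ => (hint k).abs.const_mul _]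
          simp only [integral_const_mul]
      _ ≤ (∑ k ∈ Finset.range m, |b k|) * C := by
          rw [Finset.sum_mul]
          exact Finset.sum_le_sum fun k _ => mul_le_mul_of_nonneg_left (hC k) (abs_nonneg _)
  rw [probNorm_congr hsplit]
  have h1 := probNorm_add_le (integrable_partialSum hint b m).1 (hmeas.add hmeas)
  have h2 := probNorm_add_le hmeas hmeas
  have h3 := htail c hcb hc0
  linarith

/-- The coefficient-to-sum map is continuous from the `ℓ¹`-ball with the product topology to the
topology of convergence in probability. -/
theorem continuousOn_probNorm_seriesSum (hint : ∀ j, Integrable (R j) P)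
    (hC : ∀ j, (∫ ω, |R j ω| ∂P) ≤ C)
    (htail : ∀ ε : ℝ, 0 < ε → ∃ m : ℕ, ∀ b ∈ l1Ball 1, (∀ k < m, b k = 0) →
      probNorm P (seriesSum R b) ≤ ε) :
    ContinuousOn (fun a => probNorm P (seriesSum R a)) (l1Ball 1) := by
  intro a ha
  rw [ContinuousWithinAt, Metric.tendsto_nhds]
  intro ε hε
  obtain ⟨m, hm⟩ := htail (ε / 4) (by positivity)
  have hdiff : ∀ b ∈ l1Ball 1, ∀ c ∈ l1Ball 1, probNorm P (seriesSum R b) ≤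
      probNorm P (seriesSum R c) + ((∑ k ∈ Finset.range m, |b k - c k|) * C + 2 * (ε / 4)) := by
    intro b hb c hc
    have hbs := summable_abs_of_mem_l1Ball hb
    have hcs := summable_abs_of_mem_l1Ball hc
    have hsub := sub_mem_l1Ball hb hc
    rw [one_add_one_eq_two] at hsub
    have hss := summable_abs_of_mem_l1Ball hsub
    have hadd := seriesSum_add hint hC hcs hss
    rw [add_sub_cancel] at hadd
    rw [probNorm_congr hadd]
    refine (probNorm_add_le (aestronglyMeasurable_seriesSum hint hC hcs)
      (aestronglyMeasurable_seriesSum hint hC hss)).trans ?_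
    gcongr
    exact probNorm_seriesSum_le hint hC hm hsub
  have hlim : Tendsto (fun b : ℕ → ℝ => (∑ k ∈ Finset.range m, |b k - a k|) * C)
      (nhdsWithin a (l1Ball 1)) (nhds 0) := by
    have hcont : Continuous fun b : ℕ → ℝ => (∑ k ∈ Finset.range m, |b k - a k|) * C := by
      fun_prop
    simpa using (hcont.tendsto a).mono_left nhdsWithin_le_nhds
  filter_upwards [hlim.eventually (gt_mem_nhds (half_pos hε)), self_mem_nhdsWithin] with b hb hb1
  have h1 := hdiff b hb1 a ha
  have h2 := hdiff a ha b hb1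
  simp only [abs_sub_comm (a _)] at h2
  rw [Real.dist_eq, abs_lt]
  constructor <;> linarith

/-- A small element of `L` has a representation whose first `m` coefficients are small. -/
theorem exists_small_coeff (hint : ∀ j, Integrable (R j) P)
    (hC : ∀ j, (∫ ω, |R j ω| ∂P) ≤ C)
    (htail : ∀ ε : ℝ, 0 < ε → ∃ m : ℕ, ∀ b ∈ l1Ball 1, (∀ k < m, b k = 0) →
      probNorm P (seriesSum R b) ≤ ε) (m : ℕ) {η : ℝ} (hη : 0 < η) :
    ∃ δ : ℝ, 0 < δ ∧ ∀ a ∈ l1Ball 1, probNorm P (seriesSum R a) < δ →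
      ∃ b ∈ l1Ball 2, (∀ k < m, |b k| ≤ η) ∧ seriesSum R a =ᵐ[P] seriesSum R b := by
  set U : Set (ℕ → ℝ) := {a | ∃ c ∈ l1Ball 1, probNorm P (seriesSum R c) = 0 ∧
    ∀ k < m, |a k - c k| < η} with hU
  have hUopen : IsOpen U := by
    have : U = ⋃ c ∈ {c | c ∈ l1Ball 1 ∧ probNorm P (seriesSum R c) = 0},
        ⋂ k ∈ Finset.range m, {a : ℕ → ℝ | |a k - c k| < η} := by
      ext a
      simp [hU, and_assoc]
    rw [this]
    refine isOpen_biUnion fun c _ => isOpen_biInter_finset fun k _ =>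
      isOpen_lt ?_ continuous_const
    fun_prop
  obtain ⟨δ, hδ, hδU⟩ : ∃ δ : ℝ, 0 < δ ∧ ∀ a ∈ l1Ball 1, probNorm P (seriesSum R a) < δ →
      a ∈ U := by
    rcases (l1Ball 1 \ U).eq_empty_or_nonempty with he | hne
    · exact ⟨1, one_pos, fun a ha _ => Set.sdiff_eq_empty.1 he ha⟩
    · obtain ⟨a₀, ha₀, hmin⟩ := ((isCompact_l1Ball 1).diff hUopen).exists_isMinOn hne
        ((continuousOn_probNorm_seriesSum hint hC htail).mono Set.sdiff_subset)
      refine ⟨probNorm P (seriesSum R a₀), lt_of_le_of_ne (probNorm_nonneg _) fun h0 => ?_,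
        fun a ha hlt => ?_⟩
      · exact ha₀.2 ⟨a₀, ha₀.1, h0.symm, fun k _ => by simpa using hη⟩
      · by_contra haU
        exact absurd (hmin ⟨ha, haU⟩) (not_le.2 hlt)
  refine ⟨δ, hδ, fun a ha hlt => ?_⟩
  obtain ⟨c, hc, hc0, hac⟩ := hδU a ha hlt
  have hcs := summable_abs_of_mem_l1Ball hc
  refine ⟨a - c, by simpa [one_add_one_eq_two] using sub_mem_l1Ball ha hc,
    fun k hk => (hac k hk).le, ?_⟩
  filter_upwards [seriesSum_sub hint hC (summable_abs_of_mem_l1Ball ha) hcs,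
    ae_eq_zero_of_probNorm_eq_zero (aestronglyMeasurable_seriesSum hint hC hcs) hc0] with ω h1 h2
  rw [h1, Pi.sub_apply, h2, Pi.zero_apply, sub_zero]

theorem exists_tail_small (hint : ∀ j, Integrable (R j) P)
    (hC : ∀ j, (∫ ω, |R j ω| ∂P) ≤ C)
    (hV : ∀ V : ℕ → Ω → ℝ, (∀ m, V m ∈ symmHull R m) →
      TendstoInMeasure P V atTop (fun _ => (0 : ℝ))) (ε : ℝ) (hε : 0 < ε) :
    ∃ m : ℕ, ∀ b ∈ l1Ball 1, (∀ k < m, b k = 0) → probNorm P (seriesSum R b) ≤ ε := by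
  obtain ⟨m, hm⟩ := exists_forall_mem_probNorm_le
    (fun _ _ h => (integrable_of_mem_symmHull hint h).1) hV hε
  refine ⟨m, fun b hb hb0 => ?_⟩
  exact le_of_tendsto' (tendsto_probNorm (fun n => (integrable_partialSum hint b n).1)
    (ae_tendsto_seriesSum hint hC (summable_abs_of_mem_l1Ball hb)))
    fun n => hm _ (partialSum_mem_symmHull hb hb0 n)

/-- Sequences in the `ℓ¹`-ball of radius two whose first `m` entries are at most `η`. -/
def smallHead (m : ℕ) (η : ℝ) : Set (ℕ → ℝ) :=
  {b | b ∈ l1Ball 2 ∧ ∀ k < m, |b k| ≤ η}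

theorem convex_smallHead (m : ℕ) (η : ℝ) : Convex ℝ (smallHead m η) :=
  fun _ hb _ hc _ _ hs ht hst => ⟨convex_l1Ball 2 hb.1 hc.1 hs ht hst,
    fun k hk => convex_abs_le k η (hb.2 k hk) (hc.2 k hk) hs ht hst⟩

theorem exists_smallHead_probNorm_lt (hint : ∀ j, Integrable (R j) P)
    (hC : ∀ j, (∫ ω, |R j ω| ∂P) ≤ C)
    (htail : ∀ ε : ℝ, 0 < ε → ∃ m : ℕ, ∀ b ∈ l1Ball 1, (∀ k < m, b k = 0) →
      probNorm P (seriesSum R b) ≤ ε) {ε : ℝ} (hε : 0 < ε) :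
    ∃ (m : ℕ) (η : ℝ), 0 < η ∧ ∀ b ∈ smallHead m η, probNorm P (seriesSum R b) < ε := by
  obtain ⟨m, hm⟩ := htail (ε / 8) (by positivity)
  have hC0 : 0 ≤ C := (integral_nonneg fun ω => abs_nonneg (R 0 ω)).trans (hC 0)
  have hpos : 0 < m * C + 1 := by positivity
  refine ⟨m, ε / 2 / (m * C + 1), by positivity, fun b hb => ?_⟩
  have h1 := probNorm_seriesSum_le hint hC hm hb.1
  have h2 : (∑ k ∈ Finset.range m, |b k|) * C ≤ (m * (ε / 2 / (m * C + 1))) * C := by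
    gcongr
    refine (Finset.sum_le_card_nsmul _ _ _ fun k hk => hb.2 k (Finset.mem_range.1 hk)).trans ?_
    simp
  have h3 : (m * (ε / 2 / (m * C + 1))) * C ≤ ε / 2 := by
    have : (m * (ε / 2 / (m * C + 1))) * C = (ε / 2) * (m * C / (m * C + 1)) := by ring
    rw [this]
    exact mul_le_of_le_one_right (by positivity) ((div_le_one hpos).2 (by linarith))
  linarith

end SeriesSum

/-- Proposition 4.7: local convexity (resp. local convex-solidity) of the `L⁰(P)`-topology
on `L` at `0`. -/
theorem statement14 (P : Measure Ω) [IsProbabilityMeasure P]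
    (R : ℕ → Ω → ℝ) (hint : ∀ j, Integrable (R j) P)
    (hbdd : ∃ C : ℝ, ∀ j, (∫ ω, |R j ω| ∂P) ≤ C) :
    ((∀ V : ℕ → Ω → ℝ,
        (∀ m, V m ∈ convexHull ℝ ((R '' {j | m ≤ j}) ∪ ((fun j => -R j) '' {j | m ≤ j}))) →
        TendstoInMeasure P V atTop (fun _ => (0 : ℝ))) →
      ∀ ε : ℝ, 0 < ε → ∃ δ : ℝ, 0 < δ ∧
        convexHull ℝ {G | G ∈ Lset R ∧ probDist P G (fun _ => (0 : ℝ)) < δ} ⊆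
          {Z | probDist P Z (fun _ => (0 : ℝ)) < ε}) ∧
    ((∀ W : ℕ → Ω → ℝ, IsFCC (fun j ω => |R j ω|) W →
        TendstoInMeasure P W atTop (fun _ => (0 : ℝ))) →
      ∀ ε : ℝ, 0 < ε → ∃ δ : ℝ, 0 < δ ∧
        convexHull ℝ (solidHull P {G | G ∈ Lset R ∧ probDist P G (fun _ => (0 : ℝ)) < δ}) ⊆
          {Z | probDist P Z (fun _ => (0 : ℝ)) < ε}) := by
  obtain ⟨C, hC⟩ := hbdd
  simp only [probDist_zero]
  constructor
  · intro hV ε hε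
    have htail := exists_tail_small hint hC hV
    obtain ⟨m, η, hη, hsmall⟩ := exists_smallHead_probNorm_lt hint hC htail hε
    obtain ⟨δ, hδ, hrep⟩ := exists_small_coeff hint hC htail m hη
    refine ⟨δ, hδ, fun Z hZ => ?_⟩
    obtain ⟨b, hb, hZb⟩ : Z ∈ {Z | ∃ b ∈ smallHead m η, Z =ᵐ[P] seriesSum R b} := by
      refine convexHull_min ?_ ?_ hZ
      · rintro G ⟨hG, hGδ⟩
        obtain ⟨a, ha, rfl⟩ := mem_Lset_iff.1 hG
        obtain ⟨b, hb, hbη, hab⟩ := hrep a ha hGδ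
        exact ⟨b, ⟨hb, hbη⟩, hab⟩
      · rintro X ⟨b, hb, hX⟩ Y ⟨c, hc, hY⟩ s t hs ht hst
        refine ⟨_, convex_smallHead m η hb hc hs ht hst, ?_⟩
        filter_upwards [hX, hY, seriesSum_combo hint hC (summable_abs_of_mem_l1Ball hb.1)
          (summable_abs_of_mem_l1Ball hc.1) s t] with ω h1 h2 h3
        simp [h1, h2, h3]
    exact (probNorm_congr hZb).trans_lt (hsmall b hb)
  · intro hW ε hε
    have hint' : ∀ j, Integrable (fun ω => |R j ω|) P := fun j => (hint j).abs
    have hC' : ∀ j, (∫ ω, |(|R j ω|)| ∂P) ≤ C := by simpa using hC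
    have htail := exists_tail_small hint hC
      (tendstoInMeasure_symmHull_of_isFCC hW fun _ _ => le_rfl)
    have htail' := exists_tail_small hint' hC'
      (tendstoInMeasure_symmHull_of_isFCC hW fun _ _ => (abs_abs _).le)
    obtain ⟨m, η, hη, hsmall⟩ := exists_smallHead_probNorm_lt hint' hC' htail' hε
    obtain ⟨δ, hδ, hrep⟩ := exists_small_coeff hint hC htail m hη
    refine ⟨δ, hδ, fun Z hZ => ?_⟩
    obtain ⟨b, hb, hZb⟩ : Z ∈ {Z | ∃ b ∈ smallHead m η,
        ∀ᵐ ω ∂P, |Z ω| ≤ seriesSum (fun j ω => |R j ω|) b ω} := by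
      refine convexHull_min ?_ ?_ hZ
      · rintro Y ⟨-, G, ⟨hG, hGδ⟩, hYG⟩
        obtain ⟨a, ha, rfl⟩ := mem_Lset_iff.1 hG
        obtain ⟨b, hb, hbη, hab⟩ := hrep a ha hGδ
        refine ⟨fun k => |b k|, ⟨l1Ball_of_abs_le hb fun k => (abs_abs _).le,
          fun k hk => by simpa using hbη k hk⟩, ?_⟩
        filter_upwards [hYG, hab, abs_seriesSum_le hint hC (summable_abs_of_mem_l1Ball hb)]
          with ω h1 h2 h3
        exact h1.trans (h2 ▸ h3)
      · rintro X ⟨b, hb, hX⟩ Y ⟨c, hc, hY⟩ s t hs ht hst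
        refine ⟨_, convex_smallHead m η hb hc hs ht hst, ?_⟩
        filter_upwards [hX, hY, seriesSum_combo hint' hC' (summable_abs_of_mem_l1Ball hb.1)
          (summable_abs_of_mem_l1Ball hc.1) s t] with ω h1 h2 h3
        rw [h3]
        refine (abs_add_le _ _).trans ?_
        simp only [Pi.add_apply, Pi.smul_apply, smul_eq_mul, abs_mul, abs_of_nonneg hs,
          abs_of_nonneg ht]
        gcongr
    refine (probNorm_mono (aestronglyMeasurable_seriesSum hint' hC'
      (summable_abs_of_mem_l1Ball hb.1)) ?_).trans_lt (hsmall b hb)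
    filter_upwards [hZb] with ω hω using hω.trans (le_abs_self _)

end Paper
end
end
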